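/- Assume the Riemann hypothesis. Let f be a fake μ defined via the sequence (ε_j) with ε_1 = 1, and suppose there is a least integer k with ε_k ≠ 1 (so f is of powerfree-type with critical index k, and k ≥ 2). Then there exists a real constant c₁ such that for every ε > 0 one has Σ_{n≤x} f(n) − c₁ x ≪_ε x^{1/(k+1)+ε}. -/

import Mathlib

open Filter

namespace FakeMu

noncomputable section

open Complex MeasureTheory Set Topology

/-- The fractional part, cut off below `1`. -/
def fractTail : ℝ → ℂ := indicator (Ioi 1) fun t ↦ ((Int.fract t : ℝ) : ℂ)

lemma measurable_fractTail : Measurable fractTail :=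
  (measurable_ofReal.comp measurable_fract).indicator measurableSet_Ioi

lemma norm_fract_le_one (t : ℝ) : ‖((Int.fract t : ℝ) : ℂ)‖ ≤ 1 := by
  rw [norm_real, Real.norm_of_nonneg (Int.fract_nonneg t)]
  exact (Int.fract_lt_one t).le

lemma norm_fractTail_le (t : ℝ) : ‖fractTail t‖ ≤ 1 :=
  (norm_indicator_le_norm_self _ _).trans (norm_fract_le_one t)

lemma locallyIntegrable_of_bounded {f : ℝ → ℂ} (hf : Measurable f) {C : ℝ}
    (hC : ∀ t, ‖f t‖ ≤ C) : LocallyIntegrable f := by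
  refine (locallyIntegrable_const (C : ℝ)).mono hf.aestronglyMeasurable (ae_of_all _ fun t ↦ ?_)
  exact (hC t).trans (Real.le_norm_self C)

lemma fractTail_isBigO_top : fractTail =O[atTop] fun t : ℝ ↦ t ^ (-(0 : ℝ)) := by
  refine Asymptotics.IsBigO.of_bound 1 (Eventually.of_forall fun t ↦ ?_)
  simpa using norm_fractTail_le t

lemma fractTail_isBigO_bot (b : ℝ) : fractTail =O[𝓝[>] 0] fun t : ℝ ↦ t ^ (-b) := by
  refine Asymptotics.IsBigO.of_bound 1 ?_
  filter_upwards [mem_nhdsWithin_of_mem_nhds (Iio_mem_nhds (zero_lt_one' ℝ))] with t ht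
  rw [fractTail, indicator_of_notMem (by simpa using ht.le)]
  simp

lemma mellinConvergent_fractTail {s : ℂ} (hs : s.re < 0) : MellinConvergent fractTail s :=
  mellinConvergent_of_isBigO_rpow
    (locallyIntegrable_of_bounded measurable_fractTail norm_fractTail_le |>.locallyIntegrableOn _)
    fractTail_isBigO_top hs (fractTail_isBigO_bot (s.re - 1)) (by linarith)

lemma differentiableAt_mellin_fractTail {s : ℂ} (hs : s.re < 0) :
    DifferentiableAt ℂ (mellin fractTail) s :=
  mellin_differentiableAt_of_isBigO_rpow
    (locallyIntegrable_of_bounded measurable_fractTail norm_fractTail_le |>.locallyIntegrableOn _)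
    fractTail_isBigO_top hs (fractTail_isBigO_bot (s.re - 1)) (by linarith)

lemma mellin_fractTail_eq (s : ℂ) :
    mellin fractTail s = ∫ t in Ioi (1 : ℝ), (t : ℂ) ^ (s - 1) * ((Int.fract t : ℝ) : ℂ) := by
  have : ∀ t : ℝ, (t : ℂ) ^ (s - 1) • fractTail t =
      indicator (Ioi 1) (fun t : ℝ ↦ (t : ℂ) ^ (s - 1) * ((Int.fract t : ℝ) : ℂ)) t := by
    intro t
    simp only [fractTail, indicator, smul_eq_mul]
    split_ifs <;> simp
  simp_rw [mellin, this]
  rw [setIntegral_indicator measurableSet_Ioi]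
  congr 2
  ext t; simp only [mem_inter_iff, mem_Ioi]; constructor
  · exact fun h ↦ h.2
  · exact fun h ↦ ⟨by linarith, h⟩

lemma riemannZeta₀_eq_of_one_lt {s : ℂ} (hs : 1 < s.re) :
    riemannZeta₀ s = 1 - s * mellin fractTail (-s) := by
  have hs0 : s ≠ 0 := by rintro rfl; simp at hs; linarith
  have hs1 : s ≠ 1 := by rintro rfl; simp at hs
  have hs1' : s - 1 ≠ 0 := sub_ne_zero.mpr hs1
  have h1 := LSeries_eq_mul_integral' (fun _ ↦ (1 : ℂ)) (r := 1) zero_le_one (s := s) (by simpa)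
    (by
      refine Asymptotics.IsBigO.of_bound 1 (Eventually.of_forall fun n ↦ ?_)
      simp)
  have h2 : LSeries (fun _ ↦ (1 : ℂ)) s = riemannZeta s := LSeries_one_eq_riemannZeta hs
  have h3 : ∀ t ∈ Ioi (1 : ℝ), (∑ _k ∈ Finset.Icc 1 ⌊t⌋₊, (1 : ℂ)) * (t : ℂ) ^ (-(s + 1)) =
      (t : ℂ) ^ (-s) - (t : ℂ) ^ (-s - 1) * ((Int.fract t : ℝ) : ℂ) := by
    intro t ht
    have ht0 : (0 : ℝ) < t := zero_lt_one.trans ht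
    have ht' : (t : ℂ) ≠ 0 := ofReal_ne_zero.mpr ht0.ne'
    have e1 : (t : ℂ) ^ (-s) = (t : ℂ) ^ (-s - 1) * t := by
      rw [cpow_sub _ _ ht', cpow_one]; field_simp
    have e2 : ((⌊t⌋₊ : ℕ) : ℂ) = (t : ℂ) - ((Int.fract t : ℝ) : ℂ) := by
      have : ((⌊t⌋₊ : ℕ) : ℝ) = t - Int.fract t := by
        rw [natCast_floor_eq_intCast_floor ht0.le, Int.self_sub_fract]
      exact_mod_cast congrArg (fun x : ℝ ↦ (x : ℂ)) this
    simp only [Finset.sum_const, Nat.card_Icc, add_tsub_cancel_right, nsmul_eq_mul, mul_one]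
    rw [e1, e2, show -(s + 1) = -s - 1 by ring]; ring
  have hI1 : IntegrableOn (fun t : ℝ ↦ (t : ℂ) ^ (-s)) (Ioi 1) :=
    integrableOn_Ioi_cpow_of_lt (by simpa using hs) zero_lt_one
  have hI2 : IntegrableOn (fun t : ℝ ↦ (t : ℂ) ^ (-s - 1) * ((Int.fract t : ℝ) : ℂ)) (Ioi 1) := by
    have := (mellinConvergent_fractTail (s := -s) (by simp; linarith)).mono_set
      (Ioi_subset_Ioi zero_le_one)
    refine this.congr_fun (fun t ht ↦ ?_) measurableSet_Ioi
    simp only [fractTail, smul_eq_mul]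
    rw [indicator_of_mem ht]
  rw [h2, setIntegral_congr_fun measurableSet_Ioi h3, integral_sub hI1 hI2,
    integral_Ioi_cpow_of_lt (by simpa using hs) zero_lt_one, ← mellin_fractTail_eq,
    riemannZeta_eq_inv_sub_add hs1] at h1
  have h4 : riemannZeta₀ s = s * (-(((1 : ℝ) : ℂ) ^ (-s + 1)) / (-s + 1) - mellin fractTail (-s))
    - (s - 1)⁻¹ := by rw [← h1]; ring
  rw [h4]
  simp only [ofReal_one, one_cpow]
  have : -s + 1 ≠ 0 := by rw [neg_add_eq_sub]; exact sub_ne_zero.mpr hs1.symm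
  rw [show -s + 1 = -(s - 1) by ring]
  field_simp
  ring

lemma riemannZeta₀_eq {s : ℂ} (hs : 0 < s.re) :
    riemannZeta₀ s = 1 - s * mellin fractTail (-s) := by
  have hopen : IsOpen {z : ℂ | 0 < z.re} := isOpen_lt continuous_const continuous_re
  have hA : AnalyticOnNhd ℂ riemannZeta₀ {z : ℂ | 0 < z.re} :=
    differentiable_riemannZeta₀.differentiableOn.analyticOnNhd hopen
  have hB : AnalyticOnNhd ℂ (fun s ↦ 1 - s * mellin fractTail (-s)) {z : ℂ | 0 < z.re} := by
    refine DifferentiableOn.analyticOnNhd (fun z hz ↦ ?_) hopen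
    have : DifferentiableAt ℂ (fun s ↦ mellin fractTail (-s)) z :=
      (differentiableAt_mellin_fractTail (s := -z) (by simpa using hz)).comp z
        differentiable_neg.differentiableAt
    exact (((differentiableAt_const _).sub (differentiableAt_id.mul this))).differentiableWithinAt
  refine hA.eqOn_of_preconnected_of_eventuallyEq hB
    (convex_halfSpace_re_gt 0).isPreconnected (z₀ := 2) (by simp) ?_ hs
  have : {z : ℂ | 1 < z.re} ∈ 𝓝 (2 : ℂ) :=
    (isOpen_lt continuous_const continuous_re).mem_nhds (by simp)
  filter_upwards [this] with z hz using riemannZeta₀_eq_of_one_lt hz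

lemma norm_mellin_fractTail_le {s : ℂ} (hs : 0 < s.re) :
    ‖mellin fractTail (-s)‖ ≤ 1 / s.re := by
  rw [mellin_fractTail_eq]
  have h := integral_Ioi_rpow_of_lt (a := -s.re - 1) (by linarith) zero_lt_one
  have h' : ∫ t in Ioi (1 : ℝ), t ^ (-s.re - 1) = 1 / s.re := by
    rw [h]; simp [neg_div]
  rw [← h']
  refine norm_integral_le_of_norm_le (integrableOn_Ioi_rpow_of_lt (by linarith) zero_lt_one) ?_
  filter_upwards [ae_restrict_mem measurableSet_Ioi] with t ht
  have ht0 : (0 : ℝ) < t := zero_lt_one.trans ht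
  rw [norm_mul, norm_cpow_eq_rpow_re_of_pos ht0]
  simp only [sub_re, neg_re, one_re]
  exact mul_le_of_le_one_right (by positivity) (norm_fract_le_one t)

lemma norm_riemannZeta₀_le {s : ℂ} (hs : 1 / 2 ≤ s.re) : ‖riemannZeta₀ s‖ ≤ 1 + 2 * ‖s‖ := by
  rw [riemannZeta₀_eq (by linarith)]
  refine (norm_sub_le _ _).trans ?_
  rw [norm_one, norm_mul]
  have := norm_mellin_fractTail_le (s := s) (by linarith)
  have h2 : 1 / s.re ≤ 2 := by rw [div_le_iff₀ (by linarith)]; linarith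
  nlinarith [norm_nonneg s]

lemma norm_riemannZeta_le {s : ℂ} (hs : 1 / 2 ≤ s.re) (ht : 1 ≤ |s.im|) :
    ‖riemannZeta s‖ ≤ 2 + 2 * ‖s‖ := by
  have h1 : 1 ≤ ‖s - 1‖ := by
    have := abs_im_le_norm (s - 1)
    simp at this; linarith
  have hs1 : s ≠ 1 := by rintro rfl; simp at ht; linarith
  rw [riemannZeta_eq_inv_sub_add hs1]
  refine (norm_add_le _ _).trans ?_
  have := norm_riemannZeta₀_le hs
  have h2 : ‖(s - 1)⁻¹‖ ≤ 1 := by rw [norm_inv]; exact inv_le_one_of_one_le₀ h1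
  linarith

/-- The fractional part as a complex-valued function. -/
def fractC (t : ℝ) : ℂ := ((Int.fract t : ℝ) : ℂ)

lemma measurable_fractC : Measurable fractC := measurable_ofReal.comp measurable_fract

/-- The Mellin transform of the fractional part in the strip `-1 < Re s < 0`. -/
lemma hasMellin_fractC {s : ℂ} (h0 : 0 < s.re) (h1 : s.re < 1) :
    HasMellin fractC (-s) (-riemannZeta s / s) := by
  have hs0 : s ≠ 0 := by rintro rfl; simp at h0
  have hs1 : s ≠ 1 := by rintro rfl; simp at h1
  have hs1' : s - 1 ≠ 0 := sub_ne_zero.mpr hs1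
  have hA := hasMellin_cpow_Ioc 1 (s := -s) (by simp; linarith)
  have hB : MellinConvergent fractTail (-s) := mellinConvergent_fractTail (by simpa)
  have hAB := hasMellin_add hA.1 hB
  have hval : mellin (indicator (Ioc 0 1) fun t : ℝ ↦ (t : ℂ) ^ (1 : ℂ)) (-s) +
      mellin fractTail (-s) = -riemannZeta s / s := by
    rw [hA.2, riemannZeta_eq_inv_sub_add hs1, riemannZeta₀_eq h0]
    have : -s + 1 ≠ 0 := by rw [neg_add_eq_sub]; exact sub_ne_zero.mpr hs1.symm
    rw [show -s + 1 = -(s - 1) by ring]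
    field_simp
    ring
  rw [hval] at hAB
  have hae : ∀ᵐ t : ℝ ∂volume.restrict (Ioi 0),
      (t : ℂ) ^ (-s - 1) • (indicator (Ioc 0 1) (fun t : ℝ ↦ (t : ℂ) ^ (1 : ℂ)) t + fractTail t) =
        (t : ℂ) ^ (-s - 1) • fractC t := by
    filter_upwards [ae_restrict_mem measurableSet_Ioi,
      ae_restrict_of_ae (compl_mem_ae_iff.mpr (measure_singleton (1 : ℝ)))] with t ht ht1
    congr 1
    rcases lt_or_gt_of_ne (show t ≠ 1 from ht1) with h | h
    · rw [fractTail, indicator_of_mem (show t ∈ Ioc 0 1 from ⟨ht, h.le⟩),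
        indicator_of_notMem (by simpa using h.le), cpow_one, add_zero, fractC,
        Int.fract_eq_self.mpr ⟨le_of_lt ht, h⟩]
    · rw [fractTail, indicator_of_notMem (by simp [h]), indicator_of_mem (show t ∈ Ioi 1 from h),
        zero_add, fractC]
  constructor
  · exact Integrable.congr hAB.1 hae
  · rw [← hAB.2]
    exact (integral_congr_ae hae).symm

end

noncomputable section

open Complex Metric Set Topology

/-- A nonvanishing holomorphic function on a disk, normalised at the centre, has a logarithm. -/
lemma exists_log_on_ball {f : ℂ → ℂ} {R : ℝ} (hR : 0 < R) (hf : DifferentiableOn ℂ f (ball 0 R))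
    (hne : ∀ z ∈ ball (0 : ℂ) R, f z ≠ 0) (h0 : f 0 = 1) :
    ∃ L : ℂ → ℂ, DifferentiableOn ℂ L (ball 0 R) ∧ L 0 = 0 ∧
      ∀ z ∈ ball (0 : ℂ) R, exp (L z) = f z := by
  have hd : DifferentiableOn ℂ (fun z ↦ deriv f z / f z) (ball 0 R) :=
    (hf.deriv isOpen_ball).div hf hne
  obtain ⟨g, hg⟩ := hd.isExactOn_ball
  have hg' : ∀ z ∈ ball (0 : ℂ) R, HasDerivAt g (deriv f z / f z) z := hg
  have h0R : (0 : ℂ) ∈ ball (0 : ℂ) R := mem_ball_self hR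
  refine ⟨fun z ↦ g z - g 0, fun z hz ↦ ?_, by simp, fun z hz ↦ ?_⟩
  · exact ((hg' z hz).sub_const _).differentiableAt.differentiableWithinAt
  have hder : ∀ z ∈ ball (0 : ℂ) R, HasDerivAt (fun z ↦ f z * exp (-(g z - g 0))) 0 z := by
    intro z hz
    have h1 : HasDerivAt f (deriv f z) z :=
      (hf.differentiableAt (isOpen_ball.mem_nhds hz)).hasDerivAt
    have h2 := h1.mul ((hg' z hz).sub_const (g 0)).neg.cexp
    refine h2.congr_deriv ?_
    have h3 := hne z hz
    field_simp
    ring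
  have hconst := (isOpen_ball (x := (0 : ℂ)) (ε := R)).is_const_of_deriv_eq_zero
    (convex_ball (0 : ℂ) R).isPreconnected
    (fun z hz ↦ (hder z hz).differentiableAt.differentiableWithinAt)
    (fun z hz ↦ (hder z hz).deriv) hz h0R
  simp only [sub_self, neg_zero, exp_zero, mul_one, h0] at hconst
  rw [exp_neg] at hconst
  field_simp at hconst
  exact hconst.symm

/-- A weak form of the three circles theorem. -/
lemma three_circles {L : ℂ → ℂ} {r₁ r₃ R a b : ℝ} (h1 : 0 < r₁) (h13 : r₁ < r₃) (h3R : r₃ < R)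
    (hL : DifferentiableOn ℂ L (ball 0 R)) (ha : ∀ z : ℂ, ‖z‖ = r₁ → ‖L z‖ ≤ a)
    (hb : ∀ z : ℂ, ‖z‖ = r₃ → ‖L z‖ ≤ b) {z : ℂ} (hz1 : r₁ ≤ ‖z‖) (hz3 : ‖z‖ ≤ r₃) :
    ‖L z‖ ≤ a ^ (1 - (Real.log ‖z‖ - Real.log r₁) / (Real.log r₃ - Real.log r₁)) *
      b ^ ((Real.log ‖z‖ - Real.log r₁) / (Real.log r₃ - Real.log r₁)) := by
  have h3 : 0 < r₃ := h1.trans h13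
  have hz0 : z ≠ 0 := by rintro rfl; simp at hz1; linarith
  have hmap : ∀ w : ℂ, w.re ≤ Real.log r₃ → exp w ∈ closedBall (0 : ℂ) r₃ := by
    intro w hw
    rw [mem_closedBall_zero_iff, norm_exp]
    exact (Real.le_log_iff_exp_le h3).mp hw
  have hsub : closedBall (0 : ℂ) r₃ ⊆ ball 0 R := closedBall_subset_ball h3R
  have hdiff : ∀ w : ℂ, w.re ≤ Real.log r₃ → DifferentiableAt ℂ (fun w ↦ L (exp w)) w := by
    intro w hw
    exact (hL.differentiableAt (isOpen_ball.mem_nhds (hsub (hmap w hw)))).comp w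
      differentiable_exp.differentiableAt
  have key := HadamardThreeLines.norm_le_interp_of_mem_verticalClosedStrip'
    (f := fun w ↦ L (exp w)) (z := log z) (a := a) (b := b) (l := Real.log r₁) (u := Real.log r₃)
    (Real.log_lt_log h1 h13) ?_ ?_ ?_ ?_ ?_
  · simpa [exp_log hz0, log_re] using key
  · simp only [HadamardThreeLines.verticalClosedStrip, mem_preimage, log_re, mem_Icc]
    exact ⟨Real.log_le_log h1 hz1, Real.log_le_log (by positivity) hz3⟩
  · refine DifferentiableOn.diffContOnCl fun w hw ↦ ?_
    rw [HadamardThreeLines.verticalStrip, closure_preimage_re,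
      closure_Ioo (Real.log_lt_log h1 h13).ne] at hw
    exact (hdiff w hw.2).differentiableWithinAt
  · obtain ⟨C, hC⟩ := (isCompact_closedBall (0 : ℂ) r₃).exists_bound_of_continuousOn
      (hL.continuousOn.mono hsub)
    refine ⟨C, ?_⟩
    rintro _ ⟨w, hw, rfl⟩
    exact hC _ (hmap w hw.2)
  · intro w hw
    refine ha _ ?_
    rw [norm_exp, show w.re = Real.log r₁ from hw, Real.exp_log h1]
  · intro w hw
    refine hb _ ?_
    rw [norm_exp, show w.re = Real.log r₃ from hw, Real.exp_log h3]

/-- A nonvanishing function on a disk that is bounded on a smaller disk has a logarithm that is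
small compared to the maximum of its real part, away from the boundary. -/
lemma exists_log_bound {r r₂ R A η : ℝ} (hr : 0 < r) (hr2 : r < r₂) (h2R : r₂ < R) (hA : 0 < A)
    (hη : 0 < η) :
    ∃ C : ℝ, ∀ f : ℂ → ℂ, ∀ M : ℝ, 0 < M → DifferentiableOn ℂ f (ball 0 R) →
      (∀ z ∈ ball (0 : ℂ) R, f z ≠ 0) → f 0 = 1 →
      (∀ z ∈ ball (0 : ℂ) r, ‖f z‖ ≤ Real.exp A) →
      (∀ z ∈ ball (0 : ℂ) R, ‖f z‖ ≤ Real.exp M) →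
      ∀ z : ℂ, ‖z‖ ≤ r₂ → |Real.log ‖f z‖| ≤ C + η * M := by
  have hR : 0 < R := by linarith
  set r₁ := r / 2 with hr1
  set r₃ := (r₂ + R) / 2 with hr3
  set l₁ := Real.log r₁
  set l₃ := Real.log r₃
  set l₂ := Real.log r₂
  have hl12 : l₁ < l₂ := Real.log_lt_log (by positivity) (by linarith)
  have hl23 : l₂ < l₃ := Real.log_lt_log (by linarith) (by linarith)
  set θ := (l₂ - l₁) / (l₃ - l₁) with hθ
  have hθ0 : 0 < θ := div_pos (by linarith) (by linarith)
  have hθ1 : θ < 1 := by rw [hθ, div_lt_one (by linarith)]; linarith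
  set a := 2 * A * r₁ / (r - r₁)
  have ha0 : 0 < a := div_pos (by positivity) (by linarith)
  set D := 2 * r₃ / (R - r₃)
  have hD0 : 0 < D := div_pos (by linarith) (by linarith)
  set K := D / η with hK
  have hK0 : 0 < K := by positivity
  refine ⟨(a + 1) * K ^ (θ / (1 - θ)) + (a + 1), fun f M hM hf hne h0 hfr hfR z hz ↦ ?_⟩
  obtain ⟨L, hLd, hL0, hLexp⟩ := exists_log_on_ball hR hf hne h0
  have hre : ∀ z ∈ ball (0 : ℂ) R, (L z).re = Real.log ‖f z‖ := by
    intro z hz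
    rw [← hLexp z hz, norm_exp, Real.log_exp]
  have hsub : ball (0 : ℂ) r ⊆ ball 0 R := ball_subset_ball (by linarith)
  have hsmall : ∀ w : ℂ, ‖w‖ ≤ r₁ → ‖L w‖ ≤ a := by
    intro w hw
    have hwr : w ∈ ball (0 : ℂ) r := by rw [mem_ball_zero_iff]; linarith
    have := borelCaratheodory_zero hA (hLd.mono hsub) (fun x hx ↦ ?_) hr hwr hL0
    · refine this.trans ?_
      have h1 : 0 < r - r₁ := by linarith
      simp only [a]
      gcongr
    · change (L x).re ≤ A
      rw [hre x (hsub hx)]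
      exact (Real.log_le_iff_le_exp (norm_pos_iff.mpr (hne x (hsub hx)))).mpr (hfr x hx)
  have hbig : ∀ w : ℂ, ‖w‖ ≤ r₃ → ‖L w‖ ≤ D * M := by
    intro w hw
    have hwR : w ∈ ball (0 : ℂ) R := by rw [mem_ball_zero_iff]; linarith
    have := borelCaratheodory_zero hM hLd (fun x hx ↦ ?_) hR hwR hL0
    · refine this.trans ?_
      have h1 : 0 < R - r₃ := by linarith
      have h2 : 0 ≤ 2 * M * r₃ := mul_nonneg (by positivity) (by linarith)
      have : 2 * M * ‖w‖ / (R - ‖w‖) ≤ 2 * M * r₃ / (R - r₃) := by gcongr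
      refine this.trans_eq ?_
      simp only [D]; ring
    · change (L x).re ≤ M
      rw [hre x hx]
      exact (Real.log_le_iff_le_exp (norm_pos_iff.mpr (hne x hx))).mpr (hfR x hx)
  have hzR : z ∈ ball (0 : ℂ) R := by rw [mem_ball_zero_iff]; linarith
  rw [← hre z hzR]
  refine (abs_re_le_norm _).trans ?_
  have hK1 : 0 ≤ (a + 1) * K ^ (θ / (1 - θ)) := by positivity
  rcases le_or_gt ‖z‖ r₁ with hz1 | hz1
  · have := hsmall z hz1
    have : 0 ≤ η * M := by positivity
    linarith
  -- the maximum principle on the circle of radius `r₂` and the three circles theorem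
  have hcirc : ∀ w : ℂ, ‖w‖ = r₂ → ‖L w‖ ≤ (a + 1) * K ^ (θ / (1 - θ)) + (a + 1) + η * M := by
    intro w hw
    have h3 := three_circles (a := a) (b := D * M) (by linarith) (by linarith) (by linarith) hLd
      (fun z hz ↦ hsmall z hz.le) (fun z hz ↦ hbig z hz.le) (z := w) (by linarith) (by linarith)
    rw [hw] at h3
    change ‖L w‖ ≤ a ^ (1 - θ) * (D * M) ^ θ at h3
    have hsplit : a ^ (1 - θ) * (D * M) ^ θ =
        (a * K ^ (θ / (1 - θ))) ^ (1 - θ) * (η * M) ^ θ := by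
      have hDM : D * M = K * (η * M) := by rw [hK]; field_simp
      rw [hDM, Real.mul_rpow hK0.le (by positivity), Real.mul_rpow ha0.le (by positivity),
        ← Real.rpow_mul hK0.le, div_mul_cancel₀ _ (by linarith : 0 < 1 - θ).ne']
      ring
    have hamgm := Real.geom_mean_le_arith_mean2_weighted (by linarith : 0 ≤ 1 - θ) hθ0.le
      (by positivity : 0 ≤ a * K ^ (θ / (1 - θ))) (by positivity : 0 ≤ η * M) (by ring)
    rw [← hsplit] at hamgm
    have e1 : (1 - θ) * (a * K ^ (θ / (1 - θ))) ≤ 1 * (a * K ^ (θ / (1 - θ))) := by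
      gcongr; linarith
    have e2 : θ * (η * M) ≤ 1 * (η * M) := by gcongr
    have e3 : 0 ≤ K ^ (θ / (1 - θ)) := by positivity
    nlinarith
  have hr2' : 0 < r₂ := by linarith
  refine norm_le_of_forall_mem_frontier_norm_le (f := L) (U := ball (0 : ℂ) r₂)
    isBounded_ball ((hLd.mono (by
      rw [closure_ball _ hr2'.ne']
      exact closedBall_subset_ball h2R)).diffContOnCl)
    (C := (a + 1) * K ^ (θ / (1 - θ)) + (a + 1) + η * M) (z := z)
    (fun w hw ↦ hcirc w (by
      rw [frontier_ball _ hr2'.ne'] at hw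
      simpa using hw)) ?_
  rw [closure_ball _ hr2'.ne', mem_closedBall_zero_iff]
  exact hz

/-- The Riemann hypothesis. -/
def RH : Prop := ∀ ρ : ℂ, riemannZeta ρ = 0 → 0 < ρ.re → ρ.re < 1 → ρ.re = 1 / 2

/-- The inverse of the Riemann zeta function, with value `0` at `1`. -/
def zinv (s : ℂ) : ℂ := (s - 1) / riemannZeta₁ s

lemma zinv_eq {s : ℂ} (hs : s ≠ 1) : zinv s = (riemannZeta s)⁻¹ := by
  rw [zinv, riemannZeta_eq_inv_sub_mul hs, mul_inv, inv_inv, div_eq_mul_inv]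

lemma RH.zeta_ne_zero (h : RH) {s : ℂ} (hs : 1 / 2 < s.re) : riemannZeta s ≠ 0 := by
  intro h0
  rcases le_or_gt 1 s.re with h1 | h1
  · exact riemannZeta_ne_zero_of_one_le_re h1 h0
  · have := h s h0 (by linarith) h1
    linarith

lemma RH.zeta_one_ne_zero (h : RH) {s : ℂ} (hs : 1 / 2 < s.re) : riemannZeta₁ s ≠ 0 := by
  intro h0
  by_cases h1 : s = 1
  · subst h1
    simp at h0
  · apply h.zeta_ne_zero hs
    rw [riemannZeta_eq_inv_sub_mul h1, h0, mul_zero]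

lemma RH.differentiableAt_zinv (h : RH) {s : ℂ} (hs : 1 / 2 < s.re) :
    DifferentiableAt ℂ zinv s :=
  (differentiableAt_id.sub_const 1).div differentiable_riemannZeta₁.differentiableAt
    (h.zeta_one_ne_zero hs)

/-- A Dirichlet series with bounded coefficients is bounded on closed half-planes. -/
lemma exists_LSeries_bound {σ : ℝ} (hσ : 1 < σ) :
    ∃ B : ℝ, ∀ f : ℕ → ℂ, (∀ n, ‖f n‖ ≤ 1) → ∀ s : ℂ, σ ≤ s.re → ‖LSeries f s‖ ≤ B := by
  have hsum : Summable fun n ↦ ‖LSeries.term 1 (σ : ℂ) n‖ :=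
    (LSeriesSummable_one_iff.mpr (by simpa using hσ)).norm
  refine ⟨∑' n, ‖LSeries.term 1 (σ : ℂ) n‖, fun f hf s hs ↦ ?_⟩
  refine tsum_of_norm_bounded hsum.hasSum fun n ↦ ?_
  refine (LSeries.norm_term_le s (g := 1) (by simpa using hf n)).trans ?_
  exact LSeries.norm_term_le_of_re_le_re 1 (by simpa using hs) n

lemma exists_zeta_bound :
    ∃ B : ℝ, 1 ≤ B ∧ ∀ s : ℂ, 5 / 4 ≤ s.re → ‖riemannZeta s‖ ≤ B ∧ ‖riemannZeta s‖⁻¹ ≤ B := by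
  obtain ⟨B, hB⟩ := exists_LSeries_bound (by norm_num : (1 : ℝ) < 5 / 4)
  refine ⟨max B 1, le_max_right _ _, fun s hs ↦ ?_⟩
  have hs1 : 1 < s.re := by linarith
  constructor
  · rw [← LSeries_one_eq_riemannZeta hs1]
    exact (hB 1 (by simp) s hs).trans (le_max_left _ _)
  · have hmu := LSeries_one_mul_Lseries_moebius hs1
    rw [LSeries_one_eq_riemannZeta hs1] at hmu
    rw [← norm_inv, ← eq_inv_of_mul_eq_one_right hmu]
    refine (hB _ (fun n ↦ ?_) s hs).trans (le_max_left _ _)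
    rw [norm_intCast]
    exact_mod_cast ArithmeticFunction.abs_moebius_le_one

lemma RH.exists_log_zeta_bound (h : RH) {δ η : ℝ} (hδ : 0 < δ) (hδ' : δ < 1 / 4) (hη : 0 < η) :
    ∃ C : ℝ, ∀ s : ℂ, 1 / 2 + δ ≤ s.re → s.re ≤ 2 → 3 ≤ |s.im| →
      |Real.log ‖riemannZeta s‖| ≤ C + η * Real.log (|s.im| + 10) := by
  obtain ⟨B, hB1, hB⟩ := exists_zeta_bound
  have hB0 : 0 < B := by linarith
  have hA : 0 < Real.log (B * B + 1) := Real.log_pos (by nlinarith)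
  obtain ⟨C, hC⟩ := exists_log_bound (r := 3 / 4) (r₂ := 3 / 2 - δ) (R := 3 / 2)
    (by norm_num) (by linarith) (by linarith) hA hη
  refine ⟨C + η * Real.log (2 * B) + Real.log B, fun s hs1 hs2 ht ↦ ?_⟩
  set t := s.im
  set c : ℂ := 2 + t * I
  have hcre : c.re = 2 := by simp [c]
  have hcim : c.im = t := by simp [c]
  have hc0 : riemannZeta c ≠ 0 := h.zeta_ne_zero (by rw [hcre]; norm_num)
  have hc := hB c (by rw [hcre]; norm_num)
  have hM : 0 < Real.log (2 * B * (|t| + 10)) := Real.log_pos (by nlinarith)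
  have hre : ∀ z ∈ ball (0 : ℂ) (3 / 2), 1 / 2 < (c + z).re := by
    intro z hz
    rw [mem_ball_zero_iff] at hz
    have := (abs_le.mp (abs_re_le_norm z)).1
    rw [add_re, hcre]
    linarith
  have him : ∀ z ∈ ball (0 : ℂ) (3 / 2), 1 ≤ |(c + z).im| := by
    intro z hz
    rw [mem_ball_zero_iff] at hz
    have h1 := abs_im_le_norm z
    rw [add_im, hcim]
    have h2 := abs_sub_abs_le_abs_sub t (-z.im)
    rw [abs_neg, sub_neg_eq_add] at h2
    linarith
  have key := hC (fun z ↦ riemannZeta (c + z) / riemannZeta c) _ hM ?_ ?_ ?_ ?_ ?_ (s - c) ?_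
  · simp only [add_sub_cancel] at key
    have hs0 : riemannZeta s ≠ 0 := h.zeta_ne_zero (by linarith)
    rw [norm_div, Real.log_div (norm_ne_zero_iff.mpr hs0) (norm_ne_zero_iff.mpr hc0)] at key
    have h1 : |Real.log ‖riemannZeta c‖| ≤ Real.log B := by
      rw [abs_le]
      have hp := norm_pos_iff.mpr hc0
      refine ⟨?_, Real.log_le_log hp hc.1⟩
      rw [neg_le, ← Real.log_inv]
      exact Real.log_le_log (by positivity) hc.2
    rw [Real.log_mul (by positivity) (by positivity)] at key
    have h2 := abs_sub_abs_le_abs_sub (Real.log ‖riemannZeta s‖) (Real.log ‖riemannZeta c‖)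
    linarith
  · intro z hz
    refine DifferentiableAt.differentiableWithinAt ?_
    refine DifferentiableAt.div_const ?_ _
    have h1 : c + z ≠ 1 := by
      intro h1
      have := him z hz
      rw [h1] at this
      simp at this
      linarith
    exact (differentiableAt_riemannZeta h1).comp z (by fun_prop)
  · intro z hz
    exact div_ne_zero (h.zeta_ne_zero (hre z hz)) hc0
  · simp [hc0]
  · intro z hz
    rw [mem_ball_zero_iff] at hz
    have h1 := (abs_le.mp (abs_re_le_norm z)).1
    rw [Real.exp_log (by positivity), norm_div, div_eq_mul_inv]
    have := (hB (c + z) (by rw [add_re, hcre]; linarith)).1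
    calc ‖riemannZeta (c + z)‖ * ‖riemannZeta c‖⁻¹ ≤ B * B := by gcongr; exact hc.2
      _ ≤ B * B + 1 := by linarith
  · intro z hz
    rw [Real.exp_log (by positivity), norm_div, div_eq_mul_inv]
    have h1 := norm_riemannZeta_le (hre z hz).le (him z hz)
    rw [mem_ball_zero_iff] at hz
    have h2 : ‖c + z‖ ≤ 2 + |t| + 3 / 2 := by
      refine (norm_add_le _ _).trans ?_
      have : ‖c‖ ≤ 2 + |t| := (norm_add_le _ _).trans (by simp)
      linarith
    calc ‖riemannZeta (c + z)‖ * ‖riemannZeta c‖⁻¹ ≤ (2 * (|t| + 10)) * B := by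
          gcongr
          · linarith
          · exact hc.2
      _ = _ := by ring
  · have : s - c = ((s.re - 2 : ℝ) : ℂ) := by
      apply Complex.ext <;> simp [c, t]
    rw [this, norm_real, Real.norm_eq_abs, abs_le]
    constructor <;> linarith

lemma rpow_add_ten_le {t η : ℝ} (hη : 0 < η) :
    (|t| + 10) ^ η ≤ 10 ^ η * (1 + |t|) ^ η := by
  rw [← Real.mul_rpow (by norm_num) (by positivity)]
  have := abs_nonneg t
  gcongr
  linarith

/-- Under the Riemann hypothesis, `1 / ζ` grows slower than any power to the right of the
critical line. -/
lemma RH.exists_zinv_bound (h : RH) {δ η : ℝ} (hδ : 0 < δ) (hδ' : δ < 1 / 4) (hη : 0 < η) :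
    ∃ C : ℝ, 0 < C ∧ ∀ s : ℂ, 1 / 2 + δ ≤ s.re → s.re ≤ 2 → ‖zinv s‖ ≤ C * (1 + |s.im|) ^ η := by
  obtain ⟨C₁, hC₁⟩ := h.exists_log_zeta_bound hδ hδ' hη
  have hcomp : IsCompact (Icc (1 / 2 + δ) 2 ×ℂ Icc (-3 : ℝ) 3) :=
    isCompact_Icc.reProdIm isCompact_Icc
  obtain ⟨C₂, hC₂⟩ := hcomp.exists_bound_of_continuousOn (f := zinv) (fun s hs ↦
    (h.differentiableAt_zinv (by have := hs.1.1; linarith)).continuousAt.continuousWithinAt)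
  refine ⟨max C₂ (Real.exp C₁ * 10 ^ η), lt_max_of_lt_right (by positivity), fun s hs1 hs2 ↦ ?_⟩
  have hone : (1 : ℝ) ≤ (1 + |s.im|) ^ η :=
    Real.one_le_rpow (by linarith [abs_nonneg s.im]) hη.le
  rcases le_or_gt |s.im| 3 with ht | ht
  · refine (hC₂ s ⟨⟨hs1, hs2⟩, abs_le.mp ht⟩).trans
      ((le_max_left _ (Real.exp C₁ * 10 ^ η)).trans ?_)
    exact le_mul_of_one_le_right (le_max_of_le_right (by positivity)) hone
  · have hs : s ≠ 1 := by
      rintro rfl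
      simp at ht
      linarith
    have hp := norm_pos_iff.mpr (h.zeta_ne_zero (s := s) (by linarith))
    have h1 := (abs_le.mp (hC₁ s hs1 hs2 ht.le)).1
    rw [zinv_eq hs, norm_inv, ← Real.exp_log hp, ← Real.exp_neg]
    calc Real.exp (-Real.log ‖riemannZeta s‖) ≤ Real.exp (C₁ + Real.log (|s.im| + 10) * η) := by
          gcongr; linarith
      _ = Real.exp C₁ * (|s.im| + 10) ^ η := by
          rw [Real.exp_add, Real.rpow_def_of_pos (by positivity)]
      _ ≤ Real.exp C₁ * (10 ^ η * (1 + |s.im|) ^ η) := by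
          gcongr; exact rpow_add_ten_le hη
      _ ≤ _ := by
          rw [← mul_assoc]
          gcongr
          exact le_max_right _ _

/-- The Lindelöf bound for the zeta function on vertical lines in the right half of the critical
strip, under the Riemann hypothesis. -/
lemma RH.exists_zeta_bound (h : RH) {δ η : ℝ} (hδ : 0 < δ) (hδ' : δ < 1 / 4) (hη : 0 < η) :
    ∃ C : ℝ, 0 < C ∧ ∀ s : ℂ, s.re = 1 / 2 + δ → ‖riemannZeta s‖ ≤ C * (1 + |s.im|) ^ η := by
  obtain ⟨C₁, hC₁⟩ := h.exists_log_zeta_bound hδ hδ' hη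
  have hcomp : IsCompact (({1 / 2 + δ} : Set ℝ) ×ℂ Icc (-3 : ℝ) 3) :=
    isCompact_singleton.reProdIm isCompact_Icc
  obtain ⟨C₂, hC₂⟩ := hcomp.exists_bound_of_continuousOn (f := riemannZeta) (fun s hs ↦ by
    refine (differentiableAt_riemannZeta ?_).continuousAt.continuousWithinAt
    rintro rfl
    have h1 : (1 : ℂ).re = 1 / 2 + δ := hs.1
    rw [one_re] at h1
    linarith)
  refine ⟨max C₂ (Real.exp C₁ * 10 ^ η), lt_max_of_lt_right (by positivity), fun s hs1 ↦ ?_⟩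
  have hone : (1 : ℝ) ≤ (1 + |s.im|) ^ η :=
    Real.one_le_rpow (by linarith [abs_nonneg s.im]) hη.le
  rcases le_or_gt |s.im| 3 with ht | ht
  · refine (hC₂ s ⟨hs1, abs_le.mp ht⟩).trans ((le_max_left _ (Real.exp C₁ * 10 ^ η)).trans ?_)
    exact le_mul_of_one_le_right (le_max_of_le_right (by positivity)) hone
  · have hp := norm_pos_iff.mpr (h.zeta_ne_zero (s := s) (by linarith))
    have h1 := (abs_le.mp (hC₁ s hs1.ge (by linarith) ht.le)).2
    rw [← Real.exp_log hp]
    calc Real.exp (Real.log ‖riemannZeta s‖) ≤ Real.exp (C₁ + Real.log (|s.im| + 10) * η) := by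
          gcongr; linarith
      _ = Real.exp C₁ * (|s.im| + 10) ^ η := by
          rw [Real.exp_add, Real.rpow_def_of_pos (by positivity)]
      _ ≤ Real.exp C₁ * (10 ^ η * (1 + |s.im|) ^ η) := by
          gcongr; exact rpow_add_ten_le hη
      _ ≤ _ := by
          rw [← mul_assoc]
          gcongr
          exact le_max_right _ _

end

noncomputable section

open Complex MeasureTheory Set Topology

lemma integrable_one_add_abs_rpow {p : ℝ} (hp : 1 < p) :
    Integrable fun t : ℝ ↦ (1 + |t|) ^ (-p) := by
  simpa using integrable_one_add_norm (E := ℝ) (μ := volume) (r := p) (by simpa using hp)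

lemma tendsto_one_add_abs_rpow {p : ℝ} (hp : 0 < p) :
    Tendsto (fun t : ℝ ↦ (1 + |t|) ^ (-p)) atTop (𝓝 0) :=
  (tendsto_rpow_neg_atTop hp).comp
    (tendsto_atTop_add_const_left _ _ tendsto_abs_atTop_atTop)

/-- Shifting a vertical line of integration across a strip of holomorphy. -/
lemma integral_vertical_eq {F : ℂ → ℂ} {a b C p : ℝ} (hab : a ≤ b) (hp : 1 < p)
    (hd : ∀ s : ℂ, a ≤ s.re → s.re ≤ b → DifferentiableAt ℂ F s)
    (hF : ∀ s : ℂ, a ≤ s.re → s.re ≤ b → ‖F s‖ ≤ C * (1 + |s.im|) ^ (-p)) :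
    ∫ t : ℝ, F (a + t * I) = ∫ t : ℝ, F (b + t * I) := by
  have hcont : ∀ c : ℝ, a ≤ c → c ≤ b → Continuous fun t : ℝ ↦ F (c + t * I) := by
    intro c h1 h2
    refine continuous_iff_continuousAt.mpr fun t ↦ ?_
    refine ContinuousAt.comp (f := fun t : ℝ ↦ (c + t * I : ℂ)) (g := F) ?_ (by fun_prop)
    exact (hd _ (by simpa using h1) (by simpa using h2)).continuousAt
  have hint : ∀ c : ℝ, a ≤ c → c ≤ b → Integrable fun t : ℝ ↦ F (c + t * I) := by
    intro c h1 h2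
    refine ((integrable_one_add_abs_rpow hp).const_mul C).mono'
      (hcont c h1 h2).aestronglyMeasurable (Eventually.of_forall fun t ↦ ?_)
    simpa using hF (c + t * I) (by simpa using h1) (by simpa using h2)
  have hlim : ∀ c : ℝ, a ≤ c → c ≤ b →
      Tendsto (fun T : ℝ ↦ ∫ t in (-T)..T, F (c + t * I)) atTop (𝓝 (∫ t : ℝ, F (c + t * I))) :=
    fun c h1 h2 ↦ intervalIntegral_tendsto_integral (hint c h1 h2) tendsto_neg_atTop_atBot
      tendsto_id
  have hdiff : Tendsto (fun T : ℝ ↦ (∫ t in (-T)..T, F (b + t * I)) -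
      ∫ t in (-T)..T, F (a + t * I)) atTop (𝓝 0) := by
    have hz := ((tendsto_one_add_abs_rpow (by linarith : 0 < p)).const_mul (2 * (C * (b - a))))
    rw [mul_zero] at hz
    refine squeeze_zero_norm' ?_ hz
    filter_upwards with T
    have hrect := integral_boundary_rect_eq_zero_of_differentiableOn F (a - T * I) (b + T * I)
      (by
        intro s hs
        have h1 := hs.1
        simp only [sub_re, ofReal_re, mul_re, I_re, mul_zero, ofReal_im, I_im, mul_one, sub_self,
          sub_zero, add_re, add_zero, mem_preimage, uIcc_of_le hab] at h1
        exact (hd s h1.1 h1.2).differentiableWithinAt)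
    have hh : ∀ y : ℝ, |y| = |T| →
        ‖∫ x in a..b, F (x + y * I)‖ ≤ C * (1 + |T|) ^ (-p) * (b - a) := by
      intro y hy
      have := intervalIntegral.norm_integral_le_of_norm_le_const (a := a) (b := b)
        (f := fun x : ℝ ↦ F (x + y * I)) (C := C * (1 + |T|) ^ (-p)) (fun x hx ↦ by
          rw [uIoc_of_le hab] at hx
          simpa [hy] using hF (x + y * I) (by simpa using hx.1.le) (by simpa using hx.2))
      rwa [abs_of_nonneg (sub_nonneg.mpr hab)] at this
    have h1 := hh (-T) (abs_neg T)
    have h2 := hh T rfl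
    simp only [sub_re, ofReal_re, mul_re, I_re, mul_zero, ofReal_im, I_im, mul_one, sub_self,
      sub_zero, add_re, add_zero, sub_im, mul_im, zero_sub, add_im, zero_add, smul_eq_mul,
      ofReal_neg] at hrect h1 h2
    have h3 : I * ((∫ t in (-T)..T, F (b + t * I)) - ∫ t in (-T)..T, F (a + t * I)) =
        (∫ x in a..b, F (x + T * I)) - ∫ x in a..b, F (x + -T * I) := by
      linear_combination hrect
    have h4 := congrArg norm h3
    rw [norm_mul, norm_I, one_mul] at h4
    rw [h4]
    refine (norm_sub_le _ _).trans ?_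
    linarith
  have := tendsto_nhds_unique hdiff ((hlim b hab le_rfl).sub (hlim a le_rfl hab))
  exact (sub_eq_zero.mp this.symm).symm

/-- The Mellin kernel of averaging over a unit interval. -/
def kern (N : ℝ) (w : ℂ) : ℂ := (((N + 1 : ℝ) : ℂ) ^ (1 - w) - (N : ℂ) ^ (1 - w)) / (1 - w)

lemma kern_eq_integral {N : ℝ} {w : ℂ} (hw : w.re ≤ 0) :
    kern N w = ∫ u : ℝ in N..(N + 1), (u : ℂ) ^ (-w) := by
  rw [integral_cpow (Or.inl (by simp; linarith)), kern]
  simp only [neg_add_eq_sub]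

lemma differentiableAt_kern {N : ℝ} (hN : 0 < N) {w : ℂ} (hw : w.re ≤ 0) :
    DifferentiableAt ℂ (kern N) w := by
  have hw1 : 1 - w ≠ 0 := by
    intro h
    have := congrArg re h
    simp at this
    linarith
  have h1 : ((N + 1 : ℝ) : ℂ) ≠ 0 := by exact_mod_cast (by linarith : 0 < N + 1).ne'
  have h2 : (N : ℂ) ≠ 0 := by exact_mod_cast hN.ne'
  have hd : DifferentiableAt ℂ (fun w : ℂ ↦ 1 - w) w := by fun_prop
  exact ((hd.const_cpow (Or.inl h1)).sub (hd.const_cpow (Or.inl h2))).div hd hw1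

lemma norm_kern_le {N : ℝ} (hN : 0 < N) {w : ℂ} (hw : w.re ≤ 0) :
    ‖kern N w‖ ≤ (N + 1) ^ (-w.re) := by
  rw [kern_eq_integral hw]
  have := intervalIntegral.norm_integral_le_of_norm_le_const (a := N) (b := N + 1)
    (f := fun u : ℝ ↦ (u : ℂ) ^ (-w)) (C := (N + 1) ^ (-w.re)) (fun u hu ↦ by
      rw [uIoc_of_le (by linarith)] at hu
      have hu0 : 0 < u := hN.trans hu.1
      rw [norm_cpow_eq_rpow_re_of_pos hu0, neg_re]
      exact Real.rpow_le_rpow hu0.le hu.2 (by linarith))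
  simpa using this

lemma one_add_abs_le_norm_one_sub {w : ℂ} (hw : w.re ≤ 0) : (1 + |w.im|) / 2 ≤ ‖1 - w‖ := by
  have h1 := re_le_norm (1 - w)
  have h2 := abs_im_le_norm (1 - w)
  simp at h1 h2
  linarith

lemma norm_kern_le' {N : ℝ} (hN : 0 < N) {w : ℂ} (hw : w.re ≤ 0) :
    ‖kern N w‖ ≤ 4 * (N + 1) ^ (1 - w.re) * (1 + |w.im|)⁻¹ := by
  have h0 := abs_nonneg w.im
  have h1 := one_add_abs_le_norm_one_sub hw
  have hb : ∀ u : ℝ, 0 < u → u ≤ N + 1 → ‖(u : ℂ) ^ (1 - w)‖ ≤ (N + 1) ^ (1 - w.re) := by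
    intro u hu hu'
    rw [norm_cpow_eq_rpow_re_of_pos hu, sub_re, one_re]
    exact Real.rpow_le_rpow hu.le hu' (by linarith)
  rw [kern, norm_div]
  calc _ ≤ ((N + 1) ^ (1 - w.re) + (N + 1) ^ (1 - w.re)) / ((1 + |w.im|) / 2) := by
        gcongr
        exact (norm_sub_le _ _).trans
          (add_le_add (hb _ (by linarith) le_rfl) (hb _ hN (by linarith)))
    _ = _ := by field_simp; ring

/-- Interpolation between the two bounds for `kern`. -/
lemma norm_kern_le_interp {N η : ℝ} (hN : 0 < N) (hη : 0 ≤ η) (hη' : η ≤ 1) {w : ℂ}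
    (hw : w.re ≤ 0) : ‖kern N w‖ ≤ 4 * (N + 1) ^ (-w.re + η) * (1 + |w.im|) ^ (-η) := by
  have h0 := abs_nonneg w.im
  have hN1 : 0 < N + 1 := by linarith
  calc ‖kern N w‖ = ‖kern N w‖ ^ (1 - η) * ‖kern N w‖ ^ η := by
        rcases (norm_nonneg (kern N w)).eq_or_lt with h | h
        · rw [← h]
          rcases hη.eq_or_lt with rfl | h'
          · simp
          · rw [Real.zero_rpow h'.ne', mul_zero]
        · rw [← Real.rpow_add h, sub_add_cancel, Real.rpow_one]
    _ ≤ ((N + 1) ^ (-w.re)) ^ (1 - η) * (4 * (N + 1) ^ (1 - w.re) * (1 + |w.im|)⁻¹) ^ η := by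
        gcongr
        · exact norm_kern_le hN hw
        · exact norm_kern_le' hN hw
    _ = 4 ^ η * (N + 1) ^ (-w.re + η) * (1 + |w.im|) ^ (-η) := by
        rw [Real.mul_rpow (by positivity) (by positivity), Real.mul_rpow (by positivity)
          (by positivity), ← Real.rpow_mul hN1.le, ← Real.rpow_mul hN1.le,
          Real.inv_rpow (by positivity), ← Real.rpow_neg (by positivity),
          show -w.re + η = -w.re * (1 - η) + (1 - w.re) * η by ring, Real.rpow_add hN1]
        ring
    _ ≤ 4 * (N + 1) ^ (-w.re + η) * (1 + |w.im|) ^ (-η) := by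
        gcongr
        exact Real.rpow_le_self_of_one_le (by norm_num) hη'

/-- The average of the dilates `u ↦ g (u * v)` over `[N, N + 1]`. -/
def avg (g : ℝ → ℂ) (N v : ℝ) : ℂ := ∫ u in N..(N + 1), g (u * v)

lemma continuousAt_avg {g : ℝ → ℂ} (hg : ∀ a b : ℝ, IntervalIntegrable g volume a b) (N : ℝ)
    {v : ℝ} (hv : 0 < v) : ContinuousAt (avg g N) v := by
  have hprim := intervalIntegral.continuous_primitive hg 0
  have heq : avg g N =ᶠ[𝓝 v] fun v ↦ v⁻¹ • ((∫ u in (0 : ℝ)..((N + 1) * v), g u) -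
      ∫ u in (0 : ℝ)..(N * v), g u) := by
    filter_upwards [eventually_gt_nhds hv] with x hx
    rw [avg, intervalIntegral.integral_comp_mul_right _ hx.ne',
      intervalIntegral.integral_interval_sub_left (hg _ _) (hg _ _)]
  refine ContinuousAt.congr ?_ heq.symm
  refine (continuousAt_inv₀ hv.ne').smul ?_
  exact ((hprim.comp (by fun_prop)).sub (hprim.comp (by fun_prop))).continuousAt

lemma integrable_prod_avg {g : ℝ → ℂ} (hg : Measurable g) {N : ℝ} (hN : 0 < N) {w : ℂ}
    (hw : w.re ≤ 0) (hM : MellinConvergent g w) :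
    Integrable (fun z : ℝ × ℝ ↦ (z.1 : ℂ) ^ (w - 1) • g (z.2 * z.1))
      ((volume.restrict (Ioi 0)).prod (volume.restrict (Ioc N (N + 1)))) := by
  have hmeas : Measurable fun z : ℝ × ℝ ↦ (z.1 : ℂ) ^ (w - 1) • g (z.2 * z.1) := by fun_prop
  rw [integrable_prod_iff' hmeas.aestronglyMeasurable]
  have hu0 : ∀ u ∈ Ioc N (N + 1), 0 < u := fun u hu ↦ hN.trans hu.1
  constructor
  · filter_upwards [ae_restrict_mem measurableSet_Ioc] with u hu
    exact (MellinConvergent.comp_mul_left (hu0 u hu)).mpr hM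
  · have hsm := hmeas.stronglyMeasurable.norm.integral_prod_left'
      (μ := volume.restrict (Ioi (0 : ℝ)))
    refine Integrable.mono' (g := fun _ ↦ (N + 1) ^ (-w.re) *
      ∫ v in Ioi (0 : ℝ), ‖(v : ℂ) ^ (w - 1) • g v‖) (integrable_const _)
      hsm.aestronglyMeasurable ?_
    filter_upwards [ae_restrict_mem measurableSet_Ioc] with u hu
    have hu' := hu0 u hu
    have hI : 0 ≤ ∫ v in Ioi (0 : ℝ), ‖(v : ℂ) ^ (w - 1) • g v‖ := by positivity
    have h1 : ∫ v in Ioi (0 : ℝ), ‖(v : ℂ) ^ (w - 1) • g (u * v)‖ =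
        u ^ (-w.re) * ∫ v in Ioi (0 : ℝ), ‖(v : ℂ) ^ (w - 1) • g v‖ := by
      have h2 := integral_comp_mul_left_Ioi (fun v : ℝ ↦ ‖(v : ℂ) ^ (w - 1) • g v‖) 0 hu'
      rw [mul_zero, smul_eq_mul] at h2
      calc _ = ∫ v in Ioi (0 : ℝ), u ^ (1 - w.re) *
            ‖((u * v : ℝ) : ℂ) ^ (w - 1) • g (u * v)‖ := by
            refine setIntegral_congr_fun measurableSet_Ioi fun v hv ↦ ?_
            have hv' : 0 < v := hv
            simp only [norm_smul]
            rw [norm_cpow_eq_rpow_re_of_pos hv', norm_cpow_eq_rpow_re_of_pos (mul_pos hu' hv'),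
              Real.mul_rpow hu'.le hv'.le, ← mul_assoc, ← mul_assoc, ← Real.rpow_add hu']
            simp
        _ = u ^ (-w.re) * ∫ v in Ioi (0 : ℝ), ‖(v : ℂ) ^ (w - 1) • g v‖ := by
            rw [integral_const_mul, h2, ← mul_assoc, ← Real.rpow_neg_one u, ← Real.rpow_add hu']
            congr 2
            ring
    rw [Real.norm_of_nonneg (by positivity)]
    refine h1.le.trans ?_
    gcongr
    · linarith
    · exact hu.2

lemma hasMellin_avg {g : ℝ → ℂ} (hg : Measurable g) {N : ℝ} (hN : 0 < N) {w : ℂ}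
    (hw : w.re ≤ 0) (hM : MellinConvergent g w) :
    HasMellin (avg g N) w (mellin g w * kern N w) := by
  have hint := integrable_prod_avg hg hN hw hM
  have hle : N ≤ N + 1 := by linarith
  have havg : ∀ v : ℝ, (v : ℂ) ^ (w - 1) • avg g N v =
      ∫ u in Ioc N (N + 1), (v : ℂ) ^ (w - 1) • g (u * v) := by
    intro v
    rw [avg, intervalIntegral.integral_of_le hle, integral_smul]
  constructor
  · have := hint.integral_prod_left
    simp only at this
    rw [MellinConvergent, IntegrableOn]
    simpa only [havg] using this
  · rw [mellin]
    simp only [havg]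
    rw [integral_integral_swap hint, kern_eq_integral hw, intervalIntegral.integral_of_le hle,
      ← integral_const_mul]
    refine setIntegral_congr_fun measurableSet_Ioc fun u hu ↦ ?_
    have := mellin_comp_mul_left g w (hN.trans hu.1)
    rw [mellin, smul_eq_mul] at this
    rw [this]
    ring

/-- Mellin inversion for averages. -/
lemma avg_eq_integral {g : ℝ → ℂ} (hg : Measurable g)
    (hg' : ∀ a b : ℝ, IntervalIntegrable g volume a b) {N : ℝ} (hN : 0 < N) {σ : ℝ} (hσ : σ ≤ 0)
    {M : ℂ → ℂ} (hM : ∀ w : ℂ, w.re = σ → HasMellin g w (M w))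
    (hint : Integrable fun t : ℝ ↦ M (σ + t * I) * kern N (σ + t * I)) {v : ℝ} (hv : 0 < v) :
    avg g N v = 1 / (2 * Real.pi) *
      ∫ t : ℝ, M (σ + t * I) * kern N (σ + t * I) * (v : ℂ) ^ (-(σ + t * I : ℂ)) := by
  have hmel : ∀ w : ℂ, w.re = σ → HasMellin (avg g N) w (M w * kern N w) := by
    intro w hw
    have := hasMellin_avg hg hN (hw.trans_le hσ) (hM w hw).1
    rwa [(hM w hw).2] at this
  have hval : ∀ t : ℝ, mellin (avg g N) (σ + t * I) = M (σ + t * I) * kern N (σ + t * I) :=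
    fun t ↦ (hmel _ (by simp)).2
  have h := mellinInv_mellin_eq σ (avg g N) hv (hmel σ (by simp)).1
    (by simpa only [VerticalIntegrable, hval] using hint) (continuousAt_avg hg' N hv)
  rw [← h, mellinInv]
  simp only [hval, smul_eq_mul]
  rw [real_smul]
  push_cast
  congr 1
  refine integral_congr_ae (Eventually.of_forall fun t ↦ ?_)
  ring

/-- Mellin inversion for sums of averages. -/
lemma hasSum_avg {g : ℝ → ℂ} (hg : Measurable g)
    (hg' : ∀ a b : ℝ, IntervalIntegrable g volume a b) {N : ℝ} (hN : 0 < N) {σ : ℝ} (hσ : σ ≤ 0)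
    {M : ℂ → ℂ} (hM : ∀ w : ℂ, w.re = σ → HasMellin g w (M w))
    (hint : Integrable fun t : ℝ ↦ M (σ + t * I) * kern N (σ + t * I))
    {β : ℕ → ℂ} {v : ℕ → ℝ} (hv : ∀ d, β d ≠ 0 → 0 < v d)
    (hs : Summable fun d ↦ ‖β d‖ * v d ^ (-σ)) :
    HasSum (fun d ↦ β d * avg g N (v d)) (1 / (2 * Real.pi) *
      ∫ t : ℝ, M (σ + t * I) * kern N (σ + t * I) *
        ∑' d, β d * (v d : ℂ) ^ (-(σ + t * I : ℂ))) := by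
  have hterm : ∀ (d : ℕ) (t : ℝ), ‖β d * (v d : ℂ) ^ (-(σ + t * I : ℂ))‖ =
      ‖β d‖ * v d ^ (-σ) := by
    intro d t
    rw [norm_mul]
    by_cases hd : β d = 0
    · simp [hd]
    · rw [norm_cpow_eq_rpow_re_of_pos (hv d hd)]
      simp
  have hcont : ∀ d, Continuous fun t : ℝ ↦ β d * (v d : ℂ) ^ (-(σ + t * I : ℂ)) := by
    intro d
    by_cases hd : β d = 0
    · simp [hd, continuous_const]
    · refine continuous_const.mul (Continuous.const_cpow (by fun_prop) (Or.inl ?_))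
      exact_mod_cast (hv d hd).ne'
  have hF : ∀ d, Integrable fun t : ℝ ↦ M (σ + t * I) * kern N (σ + t * I) *
      (β d * (v d : ℂ) ^ (-(σ + t * I : ℂ))) := fun d ↦
    hint.mul_bdd (c := ‖β d‖ * v d ^ (-σ)) (hcont d).aestronglyMeasurable
      (Eventually.of_forall fun t ↦ (hterm d t).le)
  have key := hasSum_integral_of_summable_integral_norm hF (by
    simp only [norm_mul _ (β _ * _), hterm]
    simp only [integral_mul_const]
    exact hs.mul_left _)
  have key2 := key.mul_left (1 / (2 * Real.pi) : ℂ)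
  simp only [tsum_mul_left] at key2
  refine key2.congr_fun fun d ↦ ?_
  by_cases hd : β d = 0
  · simp [hd]
  · rw [avg_eq_integral hg hg' hN hσ hM hint (hv d hd), mul_left_comm, ← integral_const_mul]
    congr 1
    refine integral_congr_ae (Eventually.of_forall fun t ↦ ?_)
    ring

lemma norm_avg_le {g : ℝ → ℂ} (hg : ∀ x, ‖g x‖ ≤ 1) (N v : ℝ) : ‖avg g N v‖ ≤ 1 := by
  have := intervalIntegral.norm_integral_le_of_norm_le_const (a := N) (b := N + 1)
    (f := fun u : ℝ ↦ g (u * v)) (C := 1) (fun u _ ↦ hg _)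
  simpa [avg] using this

/-- The indicator function of `(1, ∞)`. -/
def stepC : ℝ → ℂ := indicator (Ioi 1) 1

lemma measurable_stepC : Measurable stepC := measurable_const.indicator measurableSet_Ioi

lemma norm_stepC_le (x : ℝ) : ‖stepC x‖ ≤ 1 := by
  rw [stepC]
  refine (norm_indicator_le_norm_self _ _).trans ?_
  simp

lemma norm_one_sub_stepC_le (x : ℝ) : ‖1 - stepC x‖ ≤ 1 := by
  by_cases h : x ∈ Ioi (1 : ℝ) <;> simp [stepC, h]

lemma intervalIntegrable_of_norm_le_one {g : ℝ → ℂ} (hm : Measurable g) (hg : ∀ x, ‖g x‖ ≤ 1)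
    (a b : ℝ) : IntervalIntegrable g volume a b :=
  (intervalIntegrable_const (c := (1 : ℝ))).mono_fun hm.aestronglyMeasurable
    (Eventually.of_forall fun x ↦ by simpa using hg x)

lemma hasMellin_stepC {w : ℂ} (hw : w.re < 0) : HasMellin stepC w (-1 / w) := by
  have hre : (w - 1).re < -1 := by rw [sub_re, one_re]; linarith
  have heq : ∀ t : ℝ, (t : ℂ) ^ (w - 1) • stepC t =
      indicator (Ioi (1 : ℝ)) (fun t : ℝ ↦ (t : ℂ) ^ (w - 1)) t := by
    intro t
    by_cases h : t ∈ Ioi (1 : ℝ) <;> simp [stepC, h]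
  have hsub : Ioi (1 : ℝ) ∩ Ioi 0 = Ioi 1 :=
    inter_eq_left.mpr (Ioi_subset_Ioi zero_le_one)
  constructor
  · simp only [MellinConvergent, heq]
    rw [IntegrableOn, integrable_indicator_iff measurableSet_Ioi, IntegrableOn,
      Measure.restrict_restrict measurableSet_Ioi, hsub]
    exact integrableOn_Ioi_cpow_of_lt hre one_pos
  · simp only [mellin, heq]
    rw [integral_indicator measurableSet_Ioi, Measure.restrict_restrict measurableSet_Ioi, hsub,
      integral_Ioi_cpow_of_lt hre one_pos]
    simp

/-- A smoothed version of the indicator function of `(1, ∞)`. -/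
def cutoff (v : ℝ) : ℂ := avg stepC 1 v

lemma norm_cutoff_le (v : ℝ) : ‖cutoff v‖ ≤ 1 := norm_avg_le norm_stepC_le 1 v

lemma one_sub_cutoff (v : ℝ) : 1 - cutoff v = avg (fun x ↦ 1 - stepC x) 1 v := by
  have h1 : IntervalIntegrable (fun u ↦ stepC (u * v)) volume 1 (1 + 1) :=
    intervalIntegrable_of_norm_le_one (measurable_stepC.comp (measurable_mul_const v))
      (fun _ ↦ norm_stepC_le _) _ _
  rw [cutoff, avg, avg, intervalIntegral.integral_sub (by simp) h1]
  simp

lemma norm_one_sub_cutoff_le (v : ℝ) : ‖1 - cutoff v‖ ≤ 1 := by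
  rw [one_sub_cutoff v]
  exact norm_avg_le norm_one_sub_stepC_le 1 v

lemma cutoff_eq_one {v : ℝ} (hv : 1 ≤ v) : cutoff v = 1 := by
  have h : cutoff v = ∫ _u in (1 : ℝ)..(1 + 1), (1 : ℂ) := by
    rw [cutoff, avg, intervalIntegral.integral_of_le (by norm_num),
      intervalIntegral.integral_of_le (by norm_num)]
    refine setIntegral_congr_fun measurableSet_Ioc fun u hu ↦ ?_
    have : (1 : ℝ) < u * v := by nlinarith [hu.1]
    simp [stepC, this]
  simpa using h

/-- A Dirichlet series, absolutely convergent to the right of `1`, with a continuation `Z` to the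
half-plane `Re s > 1 / 2` which has small growth. -/
structure SmallGrowth (β : ℕ → ℂ) (Z : ℂ → ℂ) (δ : ℝ) : Prop where
  pos : 0 < δ
  le : δ ≤ 1 / 8
  zero : β 0 = 0
  summable : ∀ σ : ℝ, 1 < σ → Summable fun d ↦ ‖β d‖ * (d : ℝ) ^ (-σ)
  tsum_eq : ∀ s : ℂ, 1 < s.re → ∑' d, β d * (d : ℂ) ^ (-s) = Z s
  differentiableAt : ∀ s : ℂ, 1 / 2 < s.re → DifferentiableAt ℂ Z s
  bound : ∃ C : ℝ, 0 < C ∧ ∀ s : ℂ, 1 / 2 + δ ≤ s.re → s.re ≤ 2 → ‖Z s‖ ≤ C * (1 + |s.im|) ^ δ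

lemma one_add_abs_add_le (x y : ℝ) : 1 + |x + y| ≤ (1 + |x|) * (1 + |y|) := by
  have := abs_add_le x y
  nlinarith [mul_nonneg (abs_nonneg x) (abs_nonneg y)]

/-- The tails of the Dirichlet series are small on vertical lines. -/
lemma SmallGrowth.exists_tail_bound {β : ℕ → ℂ} {Z : ℂ → ℂ} {δ : ℝ} (h : SmallGrowth β Z δ)
    {k : ℕ} (hk : 2 ≤ k) :
    ∃ C : ℝ, 0 < C ∧ ∀ X : ℝ, 1 ≤ X → ∀ s : ℂ, s.re = k * (1 / 2 + δ) →
      ‖∑' d, β d * cutoff (d / X) * (d : ℂ) ^ (-s)‖ ≤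
        C * (1 + |s.im|) ^ δ * X ^ (-((k - 1) * (1 / 2 + δ))) := by
  obtain ⟨C, hC0, hC⟩ := h.bound
  have hδ := h.pos
  have hδ' := h.le
  set κ : ℝ := k * (1 / 2 + δ) with hκ
  have hk' : (2 : ℝ) ≤ k := by exact_mod_cast hk
  set c : ℝ := κ - 1 - δ with hc
  set c' : ℝ := (k - 1) * (1 / 2 + δ) with hc'
  have hcc : c' = κ - 1 / 2 - δ := by rw [hc', hκ]; ring
  have hcδ : δ ≤ c := by nlinarith
  set J : ℝ := ∫ t : ℝ, (1 + |t|) ^ (-(3 / 2 : ℝ)) with hJ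
  have hJ0 : 0 ≤ J := by positivity
  set K : ℝ := 2 / δ * (4 * 2 ^ (1 + c')) * C with hK
  have hK0 : 0 < K := by positivity
  refine ⟨K * (J + 1), by positivity, fun X hX s hs ↦ ?_⟩
  have hX0 : 0 < X := by linarith
  have hXC : (X : ℂ) ≠ 0 := by exact_mod_cast hX0.ne'
  have hw0 : ∀ w : ℂ, w.re ≤ -c → (δ / 2) * (1 + |w.im|) ≤ ‖w‖ := by
    intro w hw
    have h1 := (abs_le.mp (abs_re_le_norm w)).1
    have h2 := abs_im_le_norm w
    nlinarith [abs_nonneg w.im]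
  -- the bound on the integrand
  have hbound : ∀ w : ℂ, -c' ≤ w.re → w.re ≤ -c →
      ‖-1 / w * kern 1 w * ((X : ℂ) ^ w * Z (s + w))‖ ≤
        K * (1 + |s.im|) ^ δ * X ^ w.re * (1 + |w.im|) ^ (-(3 / 2 : ℝ)) := by
    intro w hw1 hw2
    have hi := abs_nonneg w.im
    have e1 : ‖-1 / w‖ ≤ 2 / δ * (1 + |w.im|)⁻¹ := by
      rw [norm_div, norm_neg, norm_one]
      calc 1 / ‖w‖ ≤ 1 / ((δ / 2) * (1 + |w.im|)) := by
            gcongr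
            exact hw0 w hw2
        _ = _ := by field_simp
    have e2 : ‖kern 1 w‖ ≤ 4 * 2 ^ (1 + c') * (1 + |w.im|)⁻¹ := by
      refine (norm_kern_le' one_pos (by linarith)).trans ?_
      rw [one_add_one_eq_two]
      gcongr
      · norm_num
      · linarith
    have e3 : ‖(X : ℂ) ^ w‖ = X ^ w.re := norm_cpow_eq_rpow_re_of_pos hX0 w
    have e4 : ‖Z (s + w)‖ ≤ C * ((1 + |s.im|) ^ δ * (1 + |w.im|) ^ (1 / 2 : ℝ)) := by
      refine (hC _ ?_ ?_).trans ?_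
      · rw [add_re, hs]; linarith
      · rw [add_re, hs]; linarith
      · gcongr
        rw [add_im]
        calc (1 + |s.im + w.im|) ^ δ ≤ ((1 + |s.im|) * (1 + |w.im|)) ^ δ := by
              gcongr
              exact one_add_abs_add_le _ _
          _ = (1 + |s.im|) ^ δ * (1 + |w.im|) ^ δ :=
              Real.mul_rpow (by positivity) (by positivity)
          _ ≤ _ := by
              gcongr
              · linarith
              · linarith
    have e5 : (1 + |w.im|) ^ (-(3 / 2 : ℝ)) =
        (1 + |w.im|)⁻¹ * (1 + |w.im|)⁻¹ * (1 + |w.im|) ^ (1 / 2 : ℝ) := by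
      rw [← Real.rpow_neg_one, ← Real.rpow_add (by positivity), ← Real.rpow_add (by positivity)]
      norm_num
    rw [norm_mul, norm_mul, norm_mul, e3]
    calc _ ≤ (2 / δ * (1 + |w.im|)⁻¹) * (4 * 2 ^ (1 + c') * (1 + |w.im|)⁻¹) *
          (X ^ w.re * (C * ((1 + |s.im|) ^ δ * (1 + |w.im|) ^ (1 / 2 : ℝ)))) := by gcongr
      _ = _ := by rw [e5, hK]; ring
  have hdiff : ∀ w : ℂ, -c' ≤ w.re → w.re ≤ -c →
      DifferentiableAt ℂ (fun w ↦ -1 / w * kern 1 w * ((X : ℂ) ^ w * Z (s + w))) w := by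
    intro w hw1 hw2
    have hwne : w ≠ 0 := by
      rintro rfl
      simp at hw2
      linarith
    have hZ : DifferentiableAt ℂ (fun w ↦ Z (s + w)) w :=
      (h.differentiableAt (s + w) (by rw [add_re, hs]; linarith)).comp w (by fun_prop)
    exact (((differentiableAt_const _).div differentiableAt_id hwne).mul
      (differentiableAt_kern one_pos (by linarith))).mul
      ((differentiableAt_id.const_cpow (Or.inl hXC)).mul hZ)
  -- Mellin inversion
  have hint : Integrable fun t : ℝ ↦ -1 / ((-c : ℝ) + t * I : ℂ) * kern 1 ((-c : ℝ) + t * I) := by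
    refine ((integrable_one_add_abs_rpow (p := 2) (by norm_num)).const_mul
      (2 / δ * (4 * 2 ^ (1 + c)))).mono' ?_ (Eventually.of_forall fun t ↦ ?_)
    · refine (continuous_iff_continuousAt.mpr fun t ↦ ?_).aestronglyMeasurable
      have hre : ((-c : ℝ) + t * I : ℂ).re = -c := by simp
      have hd : DifferentiableAt ℂ (fun w ↦ -1 / w * kern 1 w) ((-c : ℝ) + t * I : ℂ) := by
        refine ((differentiableAt_const _).div differentiableAt_id ?_).mul
          (differentiableAt_kern one_pos (by linarith))
        intro h0
        have := congrArg re h0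
        rw [hre, zero_re] at this
        linarith
      exact ContinuousAt.comp (f := fun t : ℝ ↦ ((-c : ℝ) + t * I : ℂ))
        (g := fun w ↦ -1 / w * kern 1 w) hd.continuousAt (by fun_prop)
    · set w : ℂ := (-c : ℝ) + t * I with hw
      have hre : w.re = -c := by simp [hw]
      have him : w.im = t := by simp [hw]
      have h1 := norm_kern_le' one_pos (w := w) (by linarith)
      have h2 := hw0 w hre.le
      rw [him] at h1 h2
      rw [hre, one_add_one_eq_two, sub_neg_eq_add] at h1
      have h3 : (0 : ℝ) < 1 + |t| := by positivity
      rw [norm_mul, norm_div, norm_neg, norm_one]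
      calc 1 / ‖w‖ * ‖kern 1 w‖ ≤ 1 / (δ / 2 * (1 + |t|)) * (4 * 2 ^ (1 + c) * (1 + |t|)⁻¹) := by
            gcongr
        _ = _ := by
            rw [Real.rpow_neg h3.le, Real.rpow_two]
            field_simp
  have hmel := hasSum_avg (g := stepC) measurable_stepC
    (intervalIntegrable_of_norm_le_one measurable_stepC norm_stepC_le) one_pos
    (σ := -c) (by linarith) (M := fun w ↦ -1 / w) (fun w hw ↦ hasMellin_stepC (by linarith)) hint
    (β := fun d ↦ β d * (d : ℂ) ^ (-s)) (v := fun d ↦ d / X)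
    (fun d hd ↦ by
      have : d ≠ 0 := by
        rintro rfl
        simp [h.zero] at hd
      positivity)
    (by
      refine ((h.summable (1 + δ) (by linarith)).mul_left (X ^ (-c))).congr fun d ↦ ?_
      rcases Nat.eq_zero_or_pos d with rfl | hd
      · simp [h.zero]
      have hd' : (0 : ℝ) < d := by exact_mod_cast hd
      rw [norm_mul, ← ofReal_natCast, norm_cpow_eq_rpow_re_of_pos hd', neg_neg,
        Real.div_rpow hd'.le hX0.le, Real.rpow_neg hX0.le, neg_re, hs,
        show -(1 + δ) = -κ + c by rw [hc]; ring, Real.rpow_add hd']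
      ring)
  have hsum : ∑' d, β d * cutoff (d / X) * (d : ℂ) ^ (-s) =
      1 / (2 * Real.pi) * ∫ t : ℝ, (fun w ↦ -1 / w * kern 1 w * ((X : ℂ) ^ w * Z (s + w)))
        ((-c : ℝ) + t * I) := by
    have e : (fun d : ℕ ↦ β d * cutoff (d / X) * (d : ℂ) ^ (-s)) =
        fun d ↦ β d * (d : ℂ) ^ (-s) * avg stepC 1 (d / X) := by
      funext d
      rw [cutoff]
      ring
    rw [e, hmel.tsum_eq]
    congr 2
    funext t
    set w : ℂ := (-c : ℝ) + t * I with hw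
    have hre : w.re = -c := by simp [hw]
    change _ = -1 / w * kern 1 w * ((X : ℂ) ^ w * Z (s + w))
    congr 1
    rw [← h.tsum_eq (s + w) (by rw [add_re, hs, hre]; linarith), ← tsum_mul_left]
    refine tsum_congr fun d ↦ ?_
    rcases Nat.eq_zero_or_pos d with rfl | hd
    · simp [h.zero]
    have hd' : (0 : ℝ) < d := by exact_mod_cast hd
    have hdC : (d : ℂ) ≠ 0 := by exact_mod_cast hd.ne'
    have hdX : ((d / X : ℝ) : ℂ) ^ (-w) * (X : ℂ) ^ (-w) = (d : ℂ) ^ (-w) := by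
      rw [← mul_cpow_ofReal_nonneg (by positivity) hX0.le, ← ofReal_mul, div_mul_cancel₀ _ hX0.ne',
        ofReal_natCast]
    rw [neg_add s w, cpow_add _ _ hdC, ← hdX, cpow_neg (X : ℂ)]
    have := (cpow_ne_zero_iff_of_exponent_ne_zero (x := (X : ℂ)) (y := w) (by
      rintro h0
      rw [h0, zero_re] at hre
      linarith)).mpr hXC
    field_simp
  have hshift := integral_vertical_eq (F := fun w ↦ -1 / w * kern 1 w * ((X : ℂ) ^ w * Z (s + w)))
    (a := -c') (b := -c) (p := 3 / 2) (C := K * (1 + |s.im|) ^ δ * X ^ (-c)) (by linarith)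
    (by norm_num) hdiff (fun w hw1 hw2 ↦ (hbound w hw1 hw2).trans (by gcongr))
  rw [hsum, ← hshift, norm_mul]
  have hpi : ‖(1 / (2 * Real.pi) : ℂ)‖ ≤ 1 := by
    rw [norm_div, norm_one, norm_mul, norm_real, Real.norm_of_nonneg Real.pi_pos.le,
      div_le_one (by simp [Real.pi_pos])]
    have := Real.pi_gt_three
    simp
    linarith
  have hI := norm_integral_le_of_norm_le
    ((integrable_one_add_abs_rpow (p := 3 / 2) (by norm_num)).const_mul
      (K * (1 + |s.im|) ^ δ * X ^ (-c')))
    (f := fun t : ℝ ↦ (fun w ↦ -1 / w * kern 1 w * ((X : ℂ) ^ w * Z (s + w))) ((-c' : ℝ) + t * I))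
    (Eventually.of_forall fun t ↦ by
      have := hbound ((-c' : ℝ) + t * I) (by simp) (by simp; linarith)
      simpa using this)
  rw [integral_const_mul] at hI
  calc _ ≤ 1 * (K * (1 + |s.im|) ^ δ * X ^ (-c') * J) := by gcongr
    _ = K * J * (1 + |s.im|) ^ δ * X ^ (-c') := by ring
    _ ≤ _ := by gcongr; linarith

lemma hasMellin_fractC' {w : ℂ} {δ : ℝ} (hδ : 0 < δ) (hδ' : δ < 1 / 4)
    (hw : w.re = -(1 / 2 + δ)) : HasMellin fractC w (riemannZeta (-w) / w) := by
  have := hasMellin_fractC (s := -w) (by rw [neg_re, hw]; linarith) (by rw [neg_re, hw]; linarith)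
  rwa [neg_neg, neg_div_neg_eq] at this

lemma inv_pow_cpow_neg {d k : ℕ} (hd : 0 < d) (w : ℂ) :
    ((((d : ℝ) ^ k)⁻¹ : ℝ) : ℂ) ^ (-w) = (d : ℂ) ^ (-(-(k * w))) := by
  have hd' : (0 : ℝ) < d := by exact_mod_cast hd
  rw [neg_neg, natCast_cpow_natCast_mul, ofReal_inv, inv_cpow, cpow_neg, inv_inv, ofReal_pow,
    ofReal_natCast]
  rw [arg_ofReal_of_nonneg (by positivity)]
  exact Real.pi_pos.ne

lemma norm_fractC_le (x : ℝ) : ‖fractC x‖ ≤ 1 :=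
  norm_fract_le_one x

lemma RH.exists_integrand_bound (hRH : RH) {β : ℕ → ℂ} {Z : ℂ → ℂ} {δ : ℝ}
    (h : SmallGrowth β Z δ) {k : ℕ} (hk : 2 ≤ k) :
    ∃ C : ℝ, 0 < C ∧ ∀ N X : ℝ, 1 ≤ N → 1 ≤ X → ∃ S : ℂ,
      HasSum (fun d : ℕ ↦ β d * cutoff (d / X) * avg fractC N ((d : ℝ) ^ k)⁻¹) S ∧
      ‖S‖ ≤ C * (N + 1) ^ (1 / 2 + 4 * δ) * X ^ (-((k - 1) * (1 / 2 + δ))) := by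
  have hδ := h.pos
  have hδ' := h.le
  obtain ⟨C₁, hC₁, hzeta⟩ := hRH.exists_zeta_bound hδ (by linarith) hδ
  obtain ⟨C₂, hC₂, htail⟩ := h.exists_tail_bound hk
  have hk' : (2 : ℝ) ≤ k := by exact_mod_cast hk
  set σ : ℝ := 1 / 2 + δ with hσ
  set J : ℝ := ∫ t : ℝ, (1 + |t|) ^ (-(1 + δ)) with hJ
  have hJ0 : 0 ≤ J := by positivity
  set K : ℝ := 4 * C₁ * 4 * (C₂ * k ^ δ) with hK
  have hK0 : 0 < K := by positivity
  refine ⟨K * (J + 1), by positivity, fun N X hN hX ↦ ?_⟩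
  have hN0 : 0 < N := by linarith
  have hX0 : 0 < X := by linarith
  have hMb : ∀ w : ℂ, w.re = -σ → ‖riemannZeta (-w) / w‖ ≤ 4 * C₁ * (1 + |w.im|) ^ (δ - 1) := by
    intro w hw
    have hi := abs_nonneg w.im
    have h1 := hzeta (-w) (by rw [neg_re, hw, neg_neg])
    rw [neg_im, abs_neg] at h1
    have h2 : (1 + |w.im|) / 4 ≤ ‖w‖ := by
      have h1 := (abs_le.mp (abs_re_le_norm w)).1
      have h2 := abs_im_le_norm w
      linarith
    rw [norm_div, Real.rpow_sub_one (by positivity)]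
    calc _ ≤ C₁ * (1 + |w.im|) ^ δ / ((1 + |w.im|) / 4) := by gcongr
      _ = _ := by field_simp
  have hcont : Continuous fun t : ℝ ↦
      riemannZeta (-((-σ : ℝ) + t * I : ℂ)) / ((-σ : ℝ) + t * I) * kern N ((-σ : ℝ) + t * I) := by
    refine continuous_iff_continuousAt.mpr fun t ↦ ?_
    set w : ℂ := (-σ : ℝ) + t * I with hw
    have hre : w.re = -σ := by simp [hw]
    have hw0 : w ≠ 0 := by
      intro h0
      rw [h0, zero_re] at hre
      linarith
    have hw1 : -w ≠ 1 := by
      intro h1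
      have := congrArg re h1
      rw [neg_re, hre, one_re] at this
      linarith
    have hd : DifferentiableAt ℂ (fun w ↦ riemannZeta (-w) / w * kern N w) w := by
      refine DifferentiableAt.mul (DifferentiableAt.div ?_ differentiableAt_id hw0)
        (differentiableAt_kern hN0 (by linarith))
      exact (differentiableAt_riemannZeta hw1).comp w (by fun_prop)
    exact ContinuousAt.comp (f := fun t : ℝ ↦ ((-σ : ℝ) + t * I : ℂ))
      (g := fun w ↦ riemannZeta (-w) / w * kern N w) hd.continuousAt (by fun_prop)
  have hint : Integrable fun t : ℝ ↦
      riemannZeta (-((-σ : ℝ) + t * I : ℂ)) / ((-σ : ℝ) + t * I) * kern N ((-σ : ℝ) + t * I) := by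
    refine ((integrable_one_add_abs_rpow (p := 2 - δ) (by linarith)).const_mul
      (4 * C₁ * (4 * (N + 1) ^ (1 + σ)))).mono' hcont.aestronglyMeasurable
      (Eventually.of_forall fun t ↦ ?_)
    set w : ℂ := (-σ : ℝ) + t * I with hw
    have hre : w.re = -σ := by simp [hw]
    have him : w.im = t := by simp [hw]
    have h1 := hMb w hre
    have h2 := norm_kern_le' hN0 (w := w) (by linarith)
    rw [him] at h1 h2
    rw [hre, sub_neg_eq_add] at h2
    have h3 : (0 : ℝ) < 1 + |t| := by positivity
    rw [norm_mul]
    calc _ ≤ (4 * C₁ * (1 + |t|) ^ (δ - 1)) * (4 * (N + 1) ^ (1 + σ) * (1 + |t|)⁻¹) := by gcongr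
      _ = _ := by
        rw [show -(2 - δ) = (δ - 1) + (-1) by ring, Real.rpow_add h3 (δ - 1), Real.rpow_neg_one]
        ring
  have hpos : ∀ d : ℕ, β d * cutoff (d / X) ≠ 0 → 0 < d := by
    intro d hd
    refine Nat.pos_of_ne_zero ?_
    rintro rfl
    simp [h.zero] at hd
  have hsum := hasSum_avg measurable_fractC
    (intervalIntegrable_of_norm_le_one measurable_fractC norm_fractC_le) hN0 (σ := -σ)
    (by linarith) (M := fun w ↦ riemannZeta (-w) / w)
    (fun w hw ↦ hasMellin_fractC' hδ (by linarith) hw) hint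
    (β := fun d ↦ β d * cutoff (d / X)) (v := fun d ↦ ((d : ℝ) ^ k)⁻¹)
    (fun d hd ↦ by
      have : (0 : ℝ) < d := by exact_mod_cast hpos d hd
      positivity)
    (by
      refine Summable.of_nonneg_of_le (fun d ↦ by positivity) (fun d ↦ ?_)
        (h.summable (k * σ) (by nlinarith))
      rcases Nat.eq_zero_or_pos d with rfl | hd
      · simp [h.zero]
      have hd' : (0 : ℝ) < d := by exact_mod_cast hd
      rw [norm_mul, neg_neg, Real.inv_rpow (by positivity), ← Real.rpow_natCast,
        ← Real.rpow_mul hd'.le, ← Real.rpow_neg hd'.le]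
      gcongr
      exact mul_le_of_le_one_right (norm_nonneg _) (norm_cutoff_le _))
  refine ⟨_, hsum, ?_⟩
  have hin : ∀ w : ℂ, ∑' d : ℕ, β d * cutoff (d / X) * ((((d : ℝ) ^ k)⁻¹ : ℝ) : ℂ) ^ (-w) =
      ∑' d : ℕ, β d * cutoff (d / X) * (d : ℂ) ^ (-(-(k * w))) := by
    intro w
    refine tsum_congr fun d ↦ ?_
    rcases Nat.eq_zero_or_pos d with rfl | hd
    · simp [h.zero]
    · rw [inv_pow_cpow_neg hd]
  have hpi : ‖(1 / (2 * Real.pi) : ℂ)‖ ≤ 1 := by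
    rw [norm_div, norm_one, norm_mul, norm_real, Real.norm_of_nonneg Real.pi_pos.le,
      div_le_one (by simp [Real.pi_pos])]
    have := Real.pi_gt_three
    simp
    linarith
  have hI := norm_integral_le_of_norm_le
    ((integrable_one_add_abs_rpow (p := 1 + δ) (by linarith)).const_mul
      (K * (N + 1) ^ (1 / 2 + 4 * δ) * X ^ (-((k - 1) * σ))))
    (f := fun t : ℝ ↦ riemannZeta (-((-σ : ℝ) + t * I : ℂ)) / ((-σ : ℝ) + t * I) *
      kern N ((-σ : ℝ) + t * I) * ∑' d : ℕ, β d * cutoff (d / X) *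
        ((((d : ℝ) ^ k)⁻¹ : ℝ) : ℂ) ^ (-((-σ : ℝ) + t * I : ℂ)))
    (Eventually.of_forall fun t ↦ by
      set w : ℂ := (-σ : ℝ) + t * I with hw
      have hre : w.re = -σ := by simp [hw]
      have him : w.im = t := by simp [hw]
      have h1 := hMb w hre
      have h2 := norm_kern_le_interp hN0 (η := 3 * δ) (by linarith) (by linarith) (w := w)
        (by linarith)
      have h4 := htail X hX (-(k * w)) (by
        rw [neg_re, ← ofReal_natCast, re_ofReal_mul, hre]; ring)
      rw [him] at h1 h2
      rw [hre, neg_neg, hσ, show 1 / 2 + δ + 3 * δ = 1 / 2 + 4 * δ by ring] at h2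
      rw [neg_im, ← ofReal_natCast, im_ofReal_mul, him, abs_neg, abs_mul, Nat.abs_cast,
        ofReal_natCast] at h4
      have h3 : (0 : ℝ) < 1 + |t| := by positivity
      have h5 : (1 + k * |t|) ^ δ ≤ k ^ δ * (1 + |t|) ^ δ := by
        rw [← Real.mul_rpow (by positivity) h3.le]
        gcongr
        nlinarith
      rw [norm_mul, norm_mul, hin]
      calc _ ≤ (4 * C₁ * (1 + |t|) ^ (δ - 1)) *
            (4 * (N + 1) ^ (1 / 2 + 4 * δ) * (1 + |t|) ^ (-(3 * δ))) *
            (C₂ * (k ^ δ * (1 + |t|) ^ δ) * X ^ (-((k - 1) * σ))) := by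
            gcongr
            exact h4.trans (by gcongr)
        _ = _ := by
            rw [show -(1 + δ) = (δ - 1) + (-(3 * δ)) + δ by ring, Real.rpow_add h3 _ δ,
              Real.rpow_add h3 (δ - 1), hK]
            ring)
  rw [integral_const_mul] at hI
  rw [norm_mul]
  calc _ ≤ 1 * (K * (N + 1) ^ (1 / 2 + 4 * δ) * X ^ (-((k - 1) * σ)) * J) := by gcongr
    _ = K * J * (N + 1) ^ (1 / 2 + 4 * δ) * X ^ (-((k - 1) * σ)) := by ring
    _ ≤ _ := by gcongr; linarith

lemma RH.exists_avg_fract_bound (hRH : RH) {β : ℕ → ℂ} {Z : ℂ → ℂ} {δ : ℝ}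
    (h : SmallGrowth β Z δ) {k : ℕ} (hk : 2 ≤ k) :
    ∃ C : ℝ, 0 < C ∧ ∀ N : ℝ, 1 ≤ N → ∃ S : ℂ,
      HasSum (fun d : ℕ ↦ β d * avg fractC N ((d : ℝ) ^ k)⁻¹) S ∧
      ‖S‖ ≤ C * (N + 1) ^ (1 / ((k : ℝ) + 1) + 4 * δ) := by
  have hδ := h.pos
  have hk' : (2 : ℝ) ≤ k := by exact_mod_cast hk
  obtain ⟨C, hC, hCb⟩ := hRH.exists_integrand_bound h hk
  have hB := h.summable (1 + δ) (by linarith)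
  set B : ℝ := ∑' d : ℕ, ‖β d‖ * (d : ℝ) ^ (-(1 + δ)) with hBdef
  have hB0 : 0 ≤ B := tsum_nonneg fun d ↦ by positivity
  refine ⟨C + B, by positivity, fun N hN ↦ ?_⟩
  have hN1 : 1 ≤ N + 1 := by linarith
  have hN0 : 0 < N + 1 := by linarith
  set X : ℝ := (N + 1) ^ (1 / ((k : ℝ) + 1)) with hXdef
  have hX : 1 ≤ X := Real.one_le_rpow hN1 (by positivity)
  have hX0 : 0 < X := by linarith
  obtain ⟨S₁, hS₁, hS₁b⟩ := hCb N X hN hX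
  have hterm : ∀ d : ℕ, ‖β d * (1 - cutoff (d / X)) * avg fractC N ((d : ℝ) ^ k)⁻¹‖ ≤
      X ^ (1 + δ) * (‖β d‖ * (d : ℝ) ^ (-(1 + δ))) := by
    intro d
    rcases Nat.eq_zero_or_pos d with rfl | hd
    · simp [h.zero]
    have hd' : (0 : ℝ) < d := by exact_mod_cast hd
    rw [norm_mul, norm_mul]
    rcases le_or_gt X d with hdX | hdX
    · rw [cutoff_eq_one ((one_le_div hX0).mpr hdX), sub_self, norm_zero, mul_zero, zero_mul]
      positivity
    · have h1 : 1 ≤ X ^ (1 + δ) * (d : ℝ) ^ (-(1 + δ)) := by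
        rw [Real.rpow_neg hd'.le, ← div_eq_mul_inv, ← Real.div_rpow hX0.le hd'.le]
        exact Real.one_le_rpow ((one_le_div hd').mpr hdX.le) (by linarith)
      calc _ ≤ ‖β d‖ * 1 * 1 := by
            gcongr
            · exact norm_one_sub_cutoff_le _
            · exact norm_avg_le norm_fractC_le _ _
        _ ≤ ‖β d‖ * (X ^ (1 + δ) * (d : ℝ) ^ (-(1 + δ))) := by
            rw [mul_one]
            gcongr
        _ = _ := by ring
  have hsum₂ : Summable fun d : ℕ ↦ β d * (1 - cutoff (d / X)) * avg fractC N ((d : ℝ) ^ k)⁻¹ :=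
    Summable.of_norm_bounded (hB.mul_left _) hterm
  have hS₂b := tsum_of_norm_bounded (hB.mul_left (X ^ (1 + δ))).hasSum hterm
  rw [tsum_mul_left, ← hBdef] at hS₂b
  refine ⟨_, (hS₁.add hsum₂.hasSum).congr_fun fun d ↦ by ring, (norm_add_le _ _).trans ?_⟩
  have e1 : X ^ (1 + δ) ≤ (N + 1) ^ (1 / ((k : ℝ) + 1) + 4 * δ) := by
    rw [hXdef, ← Real.rpow_mul hN0.le]
    refine Real.rpow_le_rpow_of_exponent_le hN1 ?_
    have : 1 / ((k : ℝ) + 1) ≤ 1 := by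
      rw [div_le_one (by positivity)]
      linarith
    nlinarith
  have e2 : (N + 1) ^ (1 / 2 + 4 * δ) * X ^ (-((k - 1) * (1 / 2 + δ))) ≤
      (N + 1) ^ (1 / ((k : ℝ) + 1) + 4 * δ) := by
    rw [hXdef, ← Real.rpow_mul hN0.le, ← Real.rpow_add hN0]
    refine Real.rpow_le_rpow_of_exponent_le hN1 ?_
    have : 1 / 2 - 1 / ((k : ℝ) + 1) = 1 / (k + 1) * ((k - 1) * (1 / 2)) := by
      field_simp
      ring
    have h2 : 0 ≤ 1 / ((k : ℝ) + 1) * ((k - 1) * δ) :=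
      mul_nonneg (by positivity) (mul_nonneg (by linarith) hδ.le)
    linarith
  calc _ ≤ C * ((N + 1) ^ (1 / 2 + 4 * δ) * X ^ (-((k - 1) * (1 / 2 + δ)))) +
        X ^ (1 + δ) * B := by
        rw [← mul_assoc]
        exact add_le_add hS₁b hS₂b
    _ ≤ C * (N + 1) ^ (1 / ((k : ℝ) + 1) + 4 * δ) +
        (N + 1) ^ (1 / ((k : ℝ) + 1) + 4 * δ) * B := by gcongr
    _ = _ := by ring

open ArithmeticFunction in
lemma coe_moebius_pow (a : ℕ) :
    ((moebius ^ a : ArithmeticFunction ℤ) : ArithmeticFunction ℂ) =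
      (moebius : ArithmeticFunction ℂ) ^ a := by
  induction a with
  | zero => rw [pow_zero, pow_zero, intCoe_one]
  | succ a ih => rw [pow_succ, pow_succ, intCoe_mul, ih]

open ArithmeticFunction in
lemma LSeries_moebius_pow (a : ℕ) {s : ℂ} (hs : 1 < s.re) :
    LSeriesSummable (fun n ↦ ((moebius : ArithmeticFunction ℂ) ^ a) n) s ∧
      LSeries (fun n ↦ ((moebius : ArithmeticFunction ℂ) ^ a) n) s = (riemannZeta s)⁻¹ ^ a := by
  have hμ : LSeriesSummable (fun n ↦ (moebius : ArithmeticFunction ℂ) n) s :=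
    LSeriesSummable_moebius_iff.mpr hs
  have hμ' : LSeries (fun n ↦ (moebius : ArithmeticFunction ℂ) n) s = (riemannZeta s)⁻¹ := by
    have := LSeries_zeta_mul_Lseries_moebius hs
    rw [LSeries_zeta_eq_riemannZeta hs] at this
    exact eq_inv_of_mul_eq_one_right this
  induction a with
  | zero =>
    have : (fun n ↦ ((moebius : ArithmeticFunction ℂ) ^ 0) n) = LSeries.delta := by
      funext n
      simp [one_apply, LSeries.delta]
    rw [this, LSeries_delta]
    refine ⟨?_, by simp⟩
    rw [LSeriesSummable]
    refine summable_of_ne_finset_zero (s := {1}) fun n hn ↦ ?_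
    rw [Finset.mem_singleton] at hn
    simp [LSeries.term_def, LSeries.delta, hn]
  | succ a ih =>
    rw [pow_succ, pow_succ, ← ih.2, ← hμ']
    exact ⟨LSeriesSummable_mul ih.1 hμ, LSeries_mul' ih.1 hμ⟩

/-- Under the Riemann hypothesis, powers of the Möbius function satisfy `SmallGrowth`. -/
lemma RH.smallGrowth_moebius_pow (hRH : RH) {a : ℕ} (ha : 1 ≤ a) {δ : ℝ} (hδ : 0 < δ)
    (hδ' : δ ≤ 1 / 8) :
    SmallGrowth (fun d ↦ ((ArithmeticFunction.moebius ^ a : ArithmeticFunction ℤ) d : ℂ))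
      (fun s ↦ zinv s ^ a) δ := by
  have hcoe : (fun d ↦ ((ArithmeticFunction.moebius ^ a : ArithmeticFunction ℤ) d : ℂ)) =
      fun d ↦ ((ArithmeticFunction.moebius : ArithmeticFunction ℂ) ^ a) d := by
    funext d
    rw [← coe_moebius_pow, ArithmeticFunction.intCoe_apply]
  rw [hcoe]
  have hterm : ∀ (s : ℂ) (d : ℕ),
      LSeries.term (fun n ↦ ((ArithmeticFunction.moebius : ArithmeticFunction ℂ) ^ a) n) s d =
        ((ArithmeticFunction.moebius : ArithmeticFunction ℂ) ^ a) d * (d : ℂ) ^ (-s) := by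
    intro s d
    rcases eq_or_ne d 0 with rfl | hd
    · simp
    · rw [LSeries.term_of_ne_zero hd, cpow_neg, div_eq_mul_inv]
  refine ⟨hδ, hδ', by simp, fun σ hσ ↦ ?_, fun s hs ↦ ?_, fun s hs ↦ ?_, ?_⟩
  · refine (LSeries_moebius_pow a (s := (σ : ℂ)) (by simpa using hσ)).1.norm.congr fun d ↦ ?_
    rw [hterm, norm_mul]
    rcases Nat.eq_zero_or_pos d with rfl | hd
    · simp
    · rw [norm_natCast_cpow_of_pos hd, neg_re, ofReal_re]
  · have h1 : s ≠ 1 := by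
      rintro rfl
      simp at hs
    rw [zinv_eq h1, ← (LSeries_moebius_pow a hs).2, LSeries]
    exact tsum_congr fun d ↦ (hterm s d).symm
  · exact (hRH.differentiableAt_zinv hs).pow a
  · have ha' : (0 : ℝ) < a := by exact_mod_cast ha
    obtain ⟨C, hC, h⟩ := hRH.exists_zinv_bound hδ (by linarith) (div_pos hδ ha')
    refine ⟨C ^ a, by positivity, fun s h1 h2 ↦ ?_⟩
    rw [norm_pow]
    calc _ ≤ (C * (1 + |s.im|) ^ (δ / a)) ^ a := by gcongr; exact h s h1 h2
      _ = _ := by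
        rw [mul_pow, ← Real.rpow_natCast ((1 + |s.im|) ^ _), ← Real.rpow_mul (by positivity),
          div_mul_cancel₀ _ ha'.ne']

end

section

open ArithmeticFunction

/-- The arithmetic function supported on `k`-th powers with value `u d` at `d ^ k`. -/
def dilate {R : Type*} [AddCommMonoid R] (k : ℕ) (u : ArithmeticFunction R) :
    ArithmeticFunction R where
  toFun n := ∑ d ∈ Finset.range (n + 1), if d ^ k = n then u d else 0
  map_zero' := by simp

section

variable {R : Type*} {k : ℕ}

lemma dilate_pow [AddCommMonoid R] (hk : k ≠ 0) (u : ArithmeticFunction R) (d : ℕ) :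
    dilate k u (d ^ k) = u d := by
  change ∑ e ∈ Finset.range (d ^ k + 1), (if e ^ k = d ^ k then u e else 0) = u d
  simp_rw [Nat.pow_left_inj hk, Finset.sum_ite_eq', Finset.mem_range]
  rw [if_pos (Nat.lt_succ_of_le (Nat.le_self_pow hk d))]

lemma dilate_eq_zero [AddCommMonoid R] (u : ArithmeticFunction R) {n : ℕ}
    (h : ∀ d, d ^ k ≠ n) : dilate k u n = 0 := by
  change ∑ d ∈ Finset.range (n + 1), (if d ^ k = n then u d else 0) = 0
  exact Finset.sum_eq_zero fun d _ ↦ if_neg (h d)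

lemma dilate_one [Semiring R] (hk : k ≠ 0) : dilate k (1 : ArithmeticFunction R) = 1 := by
  ext n
  by_cases h : ∃ d, d ^ k = n
  · obtain ⟨d, rfl⟩ := h
    rw [dilate_pow hk, one_apply, one_apply]
    simp [hk]
  · rw [dilate_eq_zero _ (by simpa using h), one_apply_ne]
    rintro rfl
    exact h ⟨1, one_pow k⟩

lemma dilate_mul [Semiring R] (hk : k ≠ 0) (u v : ArithmeticFunction R) :
    dilate k (u * v) = dilate k u * dilate k v := by
  ext n
  by_cases h : ∃ d, d ^ k = n
  · obtain ⟨d, rfl⟩ := h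
    rw [dilate_pow hk, mul_apply, mul_apply]
    refine Finset.sum_of_injOn (fun x ↦ (x.1 ^ k, x.2 ^ k)) ?_ ?_ ?_ ?_
    · intro x _ y _ hxy
      simp only [Prod.mk.injEq, Nat.pow_left_inj hk] at hxy
      exact Prod.ext hxy.1 hxy.2
    · intro x hx
      simp only [Finset.mem_coe, Nat.mem_divisorsAntidiagonal] at hx ⊢
      exact ⟨by rw [← mul_pow, hx.1], pow_ne_zero _ hx.2⟩
    · intro x hx hx'
      by_cases h1 : ∃ a, a ^ k = x.1
      · by_cases h2 : ∃ b, b ^ k = x.2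
        · obtain ⟨a, ha⟩ := h1
          obtain ⟨b, hb⟩ := h2
          refine absurd ⟨(a, b), ?_, Prod.ext ha hb⟩ hx'
          simp only [Finset.mem_coe, Nat.mem_divisorsAntidiagonal] at hx ⊢
          rw [← ha, ← hb, ← mul_pow, Nat.pow_left_inj hk] at hx
          exact ⟨hx.1, fun h ↦ hx.2 (by rw [h, zero_pow hk])⟩
        · rw [dilate_eq_zero v (by simpa using h2), mul_zero]
      · rw [dilate_eq_zero u (by simpa using h1), zero_mul]
    · intro x _
      rw [dilate_pow hk, dilate_pow hk]
  · rw [dilate_eq_zero _ (by simpa using h), mul_apply]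
    refine (Finset.sum_eq_zero fun x hx ↦ ?_).symm
    by_cases h1 : ∃ a, a ^ k = x.1
    · by_cases h2 : ∃ b, b ^ k = x.2
      · obtain ⟨a, ha⟩ := h1
        obtain ⟨b, hb⟩ := h2
        rw [Nat.mem_divisorsAntidiagonal] at hx
        exact absurd ⟨a * b, by rw [mul_pow, ha, hb, hx.1]⟩ h
      · rw [dilate_eq_zero v (by simpa using h2), mul_zero]
    · rw [dilate_eq_zero u (by simpa using h1), zero_mul]

lemma dilate_npow [Semiring R] (hk : k ≠ 0) (u : ArithmeticFunction R) (a : ℕ) :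
    dilate k (u ^ a) = dilate k u ^ a := by
  induction a with
  | zero => rw [pow_zero, pow_zero, dilate_one hk]
  | succ a ih => rw [pow_succ, pow_succ, dilate_mul hk, ih]

lemma isMultiplicative_dilate [Semiring R] (hk : k ≠ 0) {u : ArithmeticFunction R}
    (hu : u.IsMultiplicative) : (dilate k u).IsMultiplicative := by
  refine ⟨?_, fun {m n} hmn ↦ ?_⟩
  · rw [← one_pow k, dilate_pow hk, hu.1]
  by_cases h1 : ∃ a, a ^ k = m
  · by_cases h2 : ∃ b, b ^ k = n
    · obtain ⟨a, rfl⟩ := h1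
      obtain ⟨b, rfl⟩ := h2
      rw [← mul_pow, dilate_pow hk, dilate_pow hk, dilate_pow hk]
      refine hu.2 ?_
      exact (Nat.coprime_pow_left_iff (Nat.pos_of_ne_zero hk) _ _).mp
        ((Nat.coprime_pow_right_iff (Nat.pos_of_ne_zero hk) _ _).mp hmn)
    · rw [dilate_eq_zero (n := n) u (by simpa using h2), mul_zero, dilate_eq_zero]
      intro d hd
      rw [mul_comm] at hd
      obtain ⟨b, hb⟩ := exists_eq_pow_of_mul_eq_pow
        (Nat.isUnit_iff.mpr (Nat.coprime_comm.mp hmn)) hd.symm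
      exact h2 ⟨b, hb.symm⟩
  · rw [dilate_eq_zero (n := m) u (by simpa using h1), zero_mul, dilate_eq_zero]
    intro d hd
    obtain ⟨b, hb⟩ := exists_eq_pow_of_mul_eq_pow (Nat.isUnit_iff.mpr hmn) hd.symm
    exact h1 ⟨b, hb.symm⟩

end

/-- The summatory function of `dilate k u * ζ` as a sum over `k`-th powers. -/
lemma hasSum_dilate_mul_zeta {k : ℕ} (hk : k ≠ 0) (u : ArithmeticFunction ℤ) (N : ℕ) :
    HasSum (fun d : ℕ ↦ (u d : ℂ) * (N / d ^ k : ℕ))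
      ((∑ n ∈ Finset.Ioc 0 N, (dilate k u * (zeta : ArithmeticFunction ℤ)) n : ℤ) : ℂ) := by
  rw [sum_Ioc_mul_zeta_eq_sum]
  have h : HasSum (fun m : ℕ ↦ (dilate k u m : ℂ) * (N / m : ℕ))
      ((∑ n ∈ Finset.Ioc 0 N, dilate k u n * ((N / n : ℕ) : ℤ) : ℤ) : ℂ) := by
    push_cast
    refine hasSum_sum_of_ne_finset_zero fun m hm ↦ ?_
    rcases Nat.eq_zero_or_pos m with rfl | hm0
    · simp
    · rw [Nat.div_eq_of_lt (by simp at hm; omega), Nat.cast_zero, mul_zero]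
  have hinj : Function.Injective fun d : ℕ ↦ d ^ k := fun a b hab ↦ (Nat.pow_left_inj hk).mp hab
  rw [← hinj.hasSum_iff] at h
  · refine h.congr_fun fun d ↦ ?_
    simp [dilate_pow hk]
  · intro m hm
    rw [dilate_eq_zero u (by simpa using hm), Int.cast_zero, zero_mul]

lemma avg_fractC {m : ℕ} (hm : 0 < m) (N : ℕ) :
    avg fractC N (m : ℝ)⁻¹ = (N + 1 / 2) * (m : ℂ)⁻¹ - (N / m : ℕ) := by
  have hm' : (0 : ℝ) < m := by exact_mod_cast hm
  have h1 : avg fractC N (m : ℝ)⁻¹ =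
      ∫ u in (N : ℝ)..(N + 1), ((u * (m : ℝ)⁻¹ - (N / m : ℕ) : ℝ) : ℂ) := by
    refine intervalIntegral.integral_congr_Ioo_of_le (by linarith) fun u hu ↦ ?_
    have hfl : ⌊u * (m : ℝ)⁻¹⌋ = ((N / m : ℕ) : ℤ) := by
      have hu0 : 0 ≤ u := (Nat.cast_nonneg N).trans hu.1.le
      have : ⌊u⌋₊ = N := (Nat.floor_eq_iff hu0).mpr ⟨hu.1.le, hu.2⟩
      rw [← div_eq_mul_inv, ← Int.natCast_floor_eq_floor (by positivity), Nat.floor_div_natCast,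
        this]
    simp only [fractC]
    rw [Int.fract, hfl, Int.cast_natCast]
  rw [h1, intervalIntegral.integral_ofReal, intervalIntegral.integral_sub (by simp) (by simp),
    intervalIntegral.integral_mul_const, integral_id, intervalIntegral.integral_const]
  push_cast
  simp only [smul_eq_mul]
  push_cast
  ring

/-- Under the Riemann hypothesis, the summatory function of `dilate k (μ ^ a) * ζ`
has error term of exponent `1 / (k + 1)`. -/
lemma RH.exists_sum_dilate_moebius_bound (hRH : RH) {k a : ℕ} (hk : 2 ≤ k) (ha : 1 ≤ a) :
    ∃ c : ℝ, ∀ δ : ℝ, 0 < δ → δ ≤ 1 / 8 → ∃ C : ℝ, 0 ≤ C ∧ ∀ y : ℝ, 0 < y →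
      |((∑ n ∈ Finset.Ioc 0 ⌊y⌋₊,
          (dilate k (moebius ^ a) * (zeta : ArithmeticFunction ℤ)) n : ℤ) : ℝ) - c * y| ≤
        C * y ^ (1 / ((k : ℝ) + 1) + 4 * δ) := by
  have hk0 : k ≠ 0 := by omega
  have hk2 : (2 : ℝ) ≤ k := by exact_mod_cast hk
  set u : ArithmeticFunction ℤ := moebius ^ a with hu
  set c : ℝ := ∑' d : ℕ, (u d : ℝ) * ((d : ℝ) ^ k)⁻¹ with hc
  refine ⟨c, fun δ hδ hδ' ↦ ?_⟩
  have hS := hRH.smallGrowth_moebius_pow ha hδ hδ'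
  obtain ⟨C, hC0, hC⟩ := hRH.exists_avg_fract_bound hS hk
  have hcs : HasSum (fun d : ℕ ↦ (u d : ℂ) * ((d : ℂ) ^ k)⁻¹) c := by
    have : Summable fun d : ℕ ↦ (u d : ℝ) * ((d : ℝ) ^ k)⁻¹ := by
      refine Summable.of_norm ((hS.summable k (by linarith)).congr fun d ↦ ?_)
      rw [norm_mul, Real.rpow_neg (Nat.cast_nonneg d), Real.rpow_natCast, ← hu,
        Real.norm_of_nonneg (r := ((d : ℝ) ^ k)⁻¹) (by positivity)]
      simp
    have := Complex.hasSum_ofReal.mpr this.hasSum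
    refine this.congr_fun fun d ↦ ?_
    push_cast
    rfl
  have hmain : ∀ N : ℕ, 1 ≤ N →
      |((∑ n ∈ Finset.Ioc 0 N, (dilate k u * (zeta : ArithmeticFunction ℤ)) n : ℤ) : ℝ) -
        c * (N + 1 / 2)| ≤ C * ((N : ℝ) + 1) ^ (1 / ((k : ℝ) + 1) + 4 * δ) := by
    intro N hN
    obtain ⟨S, hSsum, hSb⟩ := hC N (by exact_mod_cast hN)
    have h1 := (hasSum_dilate_mul_zeta hk0 u N).add hSsum
    have h2 := hcs.mul_left ((N : ℂ) + 1 / 2)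
    have h3 := h1.unique (h2.congr_fun fun d ↦ by
      rcases Nat.eq_zero_or_pos d with rfl | hd
      · simp
      · have := avg_fractC (pow_pos hd k) N
        push_cast at this
        rw [this]
        ring)
    have h4 : S = ((c * (N + 1 / 2) -
        ((∑ n ∈ Finset.Ioc 0 N, (dilate k u * (zeta : ArithmeticFunction ℤ)) n : ℤ) : ℝ) : ℝ) :
          ℂ) := by
      rw [← eq_sub_iff_add_eq'] at h3
      rw [h3]
      push_cast
      ring
    rw [h4, Complex.norm_real, Real.norm_eq_abs, abs_sub_comm] at hSb
    exact hSb
  set τ : ℝ := 1 / ((k : ℝ) + 1) + 4 * δ with hτ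
  have hτ0 : 0 < τ := by positivity
  have hτ1 : τ ≤ 1 := by
    have : 1 / ((k : ℝ) + 1) ≤ 1 / 2 := one_div_le_one_div_of_le (by norm_num) (by linarith)
    linarith
  refine ⟨C * 2 + |c|, by positivity, fun y hy ↦ ?_⟩
  have hyτ : 0 < y ^ τ := Real.rpow_pos_of_pos hy _
  rcases lt_or_ge y 1 with hy1 | hy1
  · rw [Nat.floor_eq_zero.mpr hy1]
    simp only [Finset.Ioc_self, Finset.sum_empty, Int.cast_zero, zero_sub, abs_neg, abs_mul,
      abs_of_pos hy]
    have : y ≤ y ^ τ := by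
      simpa using Real.rpow_le_rpow_of_exponent_ge hy hy1.le hτ1
    nlinarith [abs_nonneg c]
  · set N := ⌊y⌋₊ with hN
    have hN1 : 1 ≤ N := Nat.one_le_floor_iff y |>.mpr hy1
    have hNy : (N : ℝ) ≤ y := Nat.floor_le hy.le
    have hyN : y < N + 1 := Nat.lt_floor_add_one y
    have h1 := hmain N hN1
    have h2 : ((N : ℝ) + 1) ^ τ ≤ 2 * y ^ τ := by
      calc ((N : ℝ) + 1) ^ τ ≤ (2 * y) ^ τ := by gcongr; linarith
        _ = 2 ^ τ * y ^ τ := Real.mul_rpow (by norm_num) hy.le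
        _ ≤ 2 * y ^ τ := by
          gcongr
          simpa using Real.rpow_le_rpow_of_exponent_le (x := 2) (by norm_num) hτ1
    have h3 : |c * (N + 1 / 2) - c * y| ≤ |c| * y ^ τ := by
      rw [← mul_sub, abs_mul]
      gcongr
      have : 1 ≤ y ^ τ := Real.one_le_rpow hy1 hτ0.le
      rw [abs_le]
      constructor <;> linarith
    calc _ ≤ _ := abs_sub_le _ (c * ((N : ℝ) + 1 / 2)) _
      _ ≤ C * (2 * y ^ τ) + |c| * y ^ τ := by
        gcongr
        exact h1.trans (by gcongr)
      _ = _ := by ring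

lemma mul_apply_prime_pow {R : Type*} [Semiring R] (u v : ArithmeticFunction R) {p : ℕ}
    (hp : p.Prime) (j : ℕ) :
    (u * v) (p ^ j) = ∑ i ∈ Finset.range (j + 1), u (p ^ i) * v (p ^ (j - i)) := by
  rw [mul_apply, Nat.sum_divisorsAntidiagonal fun x y ↦ u x * v y, Nat.sum_divisors_prime_pow hp]
  refine Finset.sum_congr rfl fun i hi ↦ ?_
  rw [Nat.pow_div (Nat.lt_succ_iff.mp (Finset.mem_range.mp hi)) hp.pos]

lemma dilate_zeta_prime_pow {k : ℕ} (hk : k ≠ 0) {p : ℕ} (hp : p.Prime) (j : ℕ) :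
    dilate k (zeta : ArithmeticFunction ℤ) (p ^ j) = if k ∣ j then 1 else 0 := by
  split_ifs with h
  · obtain ⟨i, rfl⟩ := h
    rw [mul_comm, pow_mul, dilate_pow hk]
    simp [hp.ne_zero]
  · refine dilate_eq_zero _ fun d hd ↦ h ?_
    obtain ⟨i, -, rfl⟩ := (Nat.dvd_prime_pow hp).mp (hd ▸ dvd_pow_self d hk)
    rw [← pow_mul] at hd
    exact ⟨i, by rw [← Nat.pow_right_injective hp.two_le hd, mul_comm]⟩

/-- Convolving with `dilate k ζ` increases the first nontrivial value by one. -/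
lemma mul_dilate_zeta_pow_apply {k : ℕ} (hk : k ≠ 0) {u : ArithmeticFunction ℤ} {p : ℕ}
    (hp : p.Prime) (h1 : u 1 = 1) (h0 : ∀ i, 1 ≤ i → i < k → u (p ^ i) = 0) (a : ℕ) :
    (u * dilate k (zeta : ArithmeticFunction ℤ) ^ a) 1 = 1 ∧
      (∀ i, 1 ≤ i → i < k → (u * dilate k (zeta : ArithmeticFunction ℤ) ^ a) (p ^ i) = 0) ∧
      (u * dilate k (zeta : ArithmeticFunction ℤ) ^ a) (p ^ k) = u (p ^ k) + a := by
  induction a with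
  | zero => simpa using ⟨h1, h0⟩
  | succ a ih =>
    rw [pow_succ, ← mul_assoc]
    set v := u * dilate k (zeta : ArithmeticFunction ℤ) ^ a
    obtain ⟨v1, v0, vk⟩ := ih
    refine ⟨?_, fun i hi1 hik ↦ ?_, ?_⟩
    · have := mul_apply_prime_pow v (dilate k (zeta : ArithmeticFunction ℤ)) hp 0
      rw [pow_zero] at this
      rw [this]
      have h2 := dilate_zeta_prime_pow hk hp 0
      rw [pow_zero] at h2
      simp [v1, h2]
    · rw [mul_apply_prime_pow _ _ hp]
      refine Finset.sum_eq_zero fun l hl ↦ ?_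
      rw [Finset.mem_range] at hl
      rcases Nat.eq_zero_or_pos l with rfl | hl0
      · rw [dilate_zeta_prime_pow hk hp, if_neg, mul_zero]
        intro h
        exact absurd (Nat.le_of_dvd (by omega) h) (by omega)
      · rw [v0 l hl0 (by omega), zero_mul]
    · rw [mul_apply_prime_pow _ _ hp, Finset.sum_range_succ,
        ← Finset.sum_subset (s₁ := {0}) (by simp; omega), Finset.sum_singleton, vk,
        dilate_zeta_prime_pow hk hp, dilate_zeta_prime_pow hk hp, pow_zero, v1]
      · simp
        ring
      · intro l hl hl0
        rw [Finset.mem_range] at hl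
        rw [Finset.mem_singleton] at hl0
        rw [v0 l (by omega) hl, zero_mul]

lemma abs_mul_dilate_zeta_pow_le {k : ℕ} (hk : k ≠ 0) {u : ArithmeticFunction ℤ} {p : ℕ}
    (hp : p.Prime) {A : ℤ} (hA : ∀ j, |u (p ^ j)| ≤ A) (a j : ℕ) :
    |(u * dilate k (zeta : ArithmeticFunction ℤ) ^ a) (p ^ j)| ≤ A * (j + 1) ^ a := by
  induction a generalizing j with
  | zero => simpa using hA j
  | succ a ih =>
    rw [pow_succ, ← mul_assoc, mul_apply_prime_pow _ _ hp]
    have hA0 : 0 ≤ A := (abs_nonneg _).trans (hA 0)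
    calc _ ≤ ∑ i ∈ Finset.range (j + 1), A * ((j : ℤ) + 1) ^ a := by
          refine (Finset.abs_sum_le_sum_abs _ _).trans (Finset.sum_le_sum fun i hi ↦ ?_)
          rw [abs_mul, dilate_zeta_prime_pow hk hp]
          have hij : (i : ℤ) ≤ j := by
            exact_mod_cast Nat.lt_succ_iff.mp (Finset.mem_range.mp hi)
          calc _ ≤ |(u * dilate k (zeta : ArithmeticFunction ℤ) ^ a) (p ^ i)| * 1 := by
                gcongr
                split_ifs <;> simp
            _ ≤ A * ((i : ℤ) + 1) ^ a := by rw [mul_one]; exact ih i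
            _ ≤ _ := by gcongr
      _ = _ := by
        rw [Finset.sum_const, Finset.card_range, nsmul_eq_mul]
        push_cast
        ring

/-- A bound for the Dirichlet series term at a prime power. -/
lemma abs_mul_rpow_prime_pow_le {g : ArithmeticFunction ℤ} {k r : ℕ} {A : ℤ} {p : ℕ}
    (hp : p.Prime) (h1 : g 1 = 1) (h0 : ∀ i, 1 ≤ i → i ≤ k → g (p ^ i) = 0)
    (hA : ∀ j : ℕ, |g (p ^ j)| ≤ A * (j + 1) ^ r) {σ : ℝ} (hσ : 0 < σ) (j : ℕ) :
    |(g (p ^ j) : ℝ)| * ((p ^ j : ℕ) : ℝ) ^ (-σ) ≤ (if j = 0 then 1 else 0) +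
      (p : ℝ) ^ (-((k + 1) * σ)) * ((((2 : ℝ) ^ (-σ)) ^ (k + 2))⁻¹ * A *
        (((j + 1 : ℕ) : ℝ) ^ r * ((2 : ℝ) ^ (-σ)) ^ (j + 1))) := by
  have hp0 : (0 : ℝ) < p := by exact_mod_cast hp.pos
  have hA0 : (0 : ℝ) ≤ A := by
    have := (abs_nonneg _).trans (hA 0)
    simp at this
    exact_mod_cast this
  set q : ℝ := 2 ^ (-σ) with hq
  have hq0 : 0 < q := by positivity
  rcases Nat.eq_zero_or_pos j with rfl | hj
  · rw [pow_zero, h1, if_pos rfl]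
    simp only [Int.cast_one, abs_one, Nat.cast_one, Real.one_rpow, mul_one]
    exact le_add_of_nonneg_right (by positivity)
  rw [if_neg hj.ne', zero_add]
  rcases le_or_gt j k with hjk | hjk
  · rw [h0 j hj hjk, Int.cast_zero, abs_zero, zero_mul]
    positivity
  · obtain ⟨i, hi⟩ := Nat.exists_eq_add_of_le (Nat.succ_le_of_lt hjk)
    have hi' : (j : ℝ) = k + 1 + i := by
      rw [hi]
      push_cast
      ring
    have e1 : ((p ^ j : ℕ) : ℝ) ^ (-σ) = (p : ℝ) ^ (-((k + 1) * σ)) * ((p : ℝ) ^ (-σ)) ^ i := by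
      rw [Nat.cast_pow, ← Real.rpow_natCast, ← Real.rpow_natCast, ← Real.rpow_mul hp0.le,
        ← Real.rpow_mul hp0.le, ← Real.rpow_add hp0, hi']
      congr 1
      ring
    have e2 : (p : ℝ) ^ (-σ) ≤ q :=
      Real.rpow_le_rpow_of_nonpos (by norm_num) (by exact_mod_cast hp.two_le) (by linarith)
    have e3 : q ^ i = (q ^ (k + 2))⁻¹ * q ^ (j + 1) := by
      rw [eq_inv_mul_iff_mul_eq₀ (by positivity), ← pow_add]
      congr 1
      omega
    have e4 : |(g (p ^ j) : ℝ)| ≤ A * ((j + 1 : ℕ) : ℝ) ^ r := by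
      have := hA j
      exact_mod_cast this
    calc |(g (p ^ j) : ℝ)| * ((p ^ j : ℕ) : ℝ) ^ (-σ) = |(g (p ^ j) : ℝ)| *
          ((p : ℝ) ^ (-((k + 1) * σ)) * ((p : ℝ) ^ (-σ)) ^ i) := by rw [e1]
      _ ≤ A * ((j + 1 : ℕ) : ℝ) ^ r * ((p : ℝ) ^ (-((k + 1) * σ)) * q ^ i) := by gcongr
      _ = _ := by
        rw [e3]
        ring

/-- Absolute convergence of the Dirichlet series of a multiplicative function vanishing at
`p, p ^ 2, …, p ^ k` with polynomial growth along prime powers. -/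
lemma summable_abs_mul_rpow {g : ArithmeticFunction ℤ} (hg : g.IsMultiplicative) {k r : ℕ}
    {A : ℤ} (h0 : ∀ p : ℕ, p.Prime → ∀ i, 1 ≤ i → i ≤ k → g (p ^ i) = 0)
    (hA : ∀ p : ℕ, p.Prime → ∀ j : ℕ, |g (p ^ j)| ≤ A * (j + 1) ^ r) {σ : ℝ}
    (hσ : 1 / ((k : ℝ) + 1) < σ) :
    Summable fun n : ℕ ↦ |(g n : ℝ)| * (n : ℝ) ^ (-σ) := by
  have hσ0 : 0 < σ := lt_trans (by positivity) hσ
  set G : ℕ → ℝ := fun n ↦ |(g n : ℝ)| * (n : ℝ) ^ (-σ) with hG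
  have hG0 : ∀ n, 0 ≤ G n := fun n ↦ by positivity
  have hG1 : G 1 = 1 := by simp [hG, hg.1]
  have hGm : ∀ {m n : ℕ}, m.Coprime n → G (m * n) = G m * G n := by
    intro m n hmn
    simp only [hG]
    rw [hg.2 hmn]
    push_cast
    rw [abs_mul, Real.mul_rpow (Nat.cast_nonneg _) (Nat.cast_nonneg _)]
    ring
  set q : ℝ := 2 ^ (-σ) with hq
  have hq0 : 0 < q := by positivity
  have hq1 : q < 1 := Real.rpow_lt_one_of_one_lt_of_neg (by norm_num) (by linarith)
  have hA0 : (0 : ℝ) ≤ A := by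
    have := (abs_nonneg _).trans (hA 2 Nat.prime_two 0)
    simp at this
    exact_mod_cast this
  set M : ℕ → ℝ := fun j ↦ (q ^ (k + 2))⁻¹ * A * (((j + 1 : ℕ) : ℝ) ^ r * q ^ (j + 1)) with hM
  have hMs : Summable M := by
    refine Summable.mul_left _ ?_
    exact (summable_nat_add_iff (f := fun n : ℕ ↦ (n : ℝ) ^ r * q ^ n) 1).mpr
      (summable_pow_mul_geometric_of_norm_lt_one r (by rwa [Real.norm_of_nonneg hq0.le]))
  have hM0 : ∀ j, 0 ≤ M j := fun j ↦ by positivity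
  set s : ℝ := (k + 1) * σ with hs
  have hs1 : 1 < s := by
    rw [div_lt_iff₀ (by positivity)] at hσ
    linarith
  have hloc : ∀ p : ℕ, p.Prime → ∀ j : ℕ,
      G (p ^ j) ≤ (if j = 0 then 1 else 0) + (p : ℝ) ^ (-s) * M j :=
    fun p hp j ↦ abs_mul_rpow_prime_pow_le hp hg.1 (h0 p hp) (hA p hp) hσ0 j
  have hind : HasSum (fun j : ℕ ↦ if j = 0 then (1 : ℝ) else 0) 1 := hasSum_ite_eq 0 1
  set K : ℝ := ∑' j, M j with hK
  have hK0 : 0 ≤ K := tsum_nonneg hM0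
  have hmaj : ∀ p : ℕ, HasSum (fun j ↦ (if j = 0 then (1 : ℝ) else 0) + (p : ℝ) ^ (-s) * M j)
      (1 + (p : ℝ) ^ (-s) * K) := fun p ↦ hind.add (hMs.hasSum.mul_left _)
  have hsummable : ∀ {p : ℕ}, p.Prime → Summable fun n : ℕ ↦ ‖G (p ^ n)‖ := fun {p} hp ↦
    Summable.of_nonneg_of_le (fun _ ↦ norm_nonneg _)
      (fun j ↦ by rw [Real.norm_of_nonneg (hG0 _)]; exact hloc p hp j) (hmaj p).summable
  have hζ : Summable fun n : ℕ ↦ (n : ℝ) ^ (-s) := Real.summable_nat_rpow.mpr (by linarith)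
  refine summable_of_sum_range_le (c := Real.exp (K * ∑' n : ℕ, (n : ℝ) ^ (-s))) hG0 fun N ↦ ?_
  have hE := (EulerProduct.summable_and_hasSum_smoothNumbers_prod_primesBelow_tsum hG1 hGm
    hsummable N).2
  have hE' := (hasSum_subtype_iff_indicator (f := G) (s := N.smoothNumbers)).mp hE
  calc ∑ n ∈ Finset.range N, G n
      = ∑ n ∈ Finset.range N, (N.smoothNumbers).indicator G n := by
        refine Finset.sum_congr rfl fun n hn ↦ ?_
        rcases Nat.eq_zero_or_pos n with rfl | hn0
        · simp [hG, Set.indicator]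
        · rw [Set.indicator_of_mem (Nat.mem_smoothNumbers_of_lt hn0 (Finset.mem_range.mp hn))]
    _ ≤ ∏ p ∈ N.primesBelow, ∑' n : ℕ, G (p ^ n) :=
        sum_le_hasSum _ (fun n _ ↦ Set.indicator_nonneg (fun n _ ↦ hG0 n) n) hE'
    _ ≤ ∏ p ∈ N.primesBelow, Real.exp ((p : ℝ) ^ (-s) * K) := by
        refine Finset.prod_le_prod (fun p _ ↦ tsum_nonneg fun n ↦ hG0 _) fun p hp ↦ ?_
        have hp := Nat.prime_of_mem_primesBelow hp
        calc _ ≤ 1 + (p : ℝ) ^ (-s) * K := by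
              rw [← (hmaj p).tsum_eq]
              exact (hsummable hp).of_norm.tsum_le_tsum (hloc p hp) (hmaj p).summable
          _ ≤ _ := by
              rw [add_comm]
              exact Real.add_one_le_exp _
    _ = Real.exp (K * ∑ p ∈ N.primesBelow, (p : ℝ) ^ (-s)) := by
        rw [← Real.exp_sum, ← Finset.sum_mul, mul_comm]
    _ ≤ _ := by
        gcongr
        exact hζ.sum_le_tsum _ fun n _ ↦ by positivity

/-- Under the Riemann hypothesis, the error term for `dilate k (μ ^ a) * ζ` persists after
convolution with a function whose Dirichlet series converges absolutely to the right of
`1 / (k + 1)`. -/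
lemma RH.exists_sum_bound (hRH : RH) {k a : ℕ} (hk : 2 ≤ k) (ha : 1 ≤ a)
    {g : ArithmeticFunction ℤ}
    (hg : ∀ σ : ℝ, 1 / ((k : ℝ) + 1) < σ → Summable fun n : ℕ ↦ |(g n : ℝ)| * (n : ℝ) ^ (-σ)) :
    ∃ c₁ : ℝ, ∀ ε' : ℝ, 0 < ε' → ∃ C : ℝ, ∀ x : ℝ, 1 ≤ x →
      |((∑ n ∈ Finset.Ioc 0 ⌊x⌋₊,
          (g * (dilate k (moebius ^ a) * (zeta : ArithmeticFunction ℤ))) n : ℤ) : ℝ) - c₁ * x| ≤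
        C * x ^ (1 / ((k : ℝ) + 1) + ε') := by
  obtain ⟨c, hc⟩ := hRH.exists_sum_dilate_moebius_bound hk ha
  set T := dilate k (moebius ^ a) * (zeta : ArithmeticFunction ℤ)
  have hk0 : (0 : ℝ) < k := by exact_mod_cast (by omega : 0 < k)
  have hg1 : Summable fun e : ℕ ↦ (g e : ℝ) * (e : ℝ)⁻¹ := by
    refine Summable.of_norm ((hg 1 ?_).congr fun e ↦ ?_)
    · rw [div_lt_one (by positivity)]
      linarith
    · rw [Real.rpow_neg_one, Real.norm_eq_abs, abs_mul,
        abs_of_nonneg (a := (e : ℝ)⁻¹) (by positivity)]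
  refine ⟨c * ∑' e : ℕ, (g e : ℝ) * (e : ℝ)⁻¹, fun ε' hε' ↦ ?_⟩
  set δ : ℝ := min (1 / 8) (ε' / 4) with hδdef
  have hδ : 0 < δ := lt_min (by norm_num) (by linarith)
  have hδε : 4 * δ ≤ ε' := by linarith [min_le_right (1 / 8) (ε' / 4)]
  obtain ⟨C, hC0, hC⟩ := hc δ hδ (min_le_left _ _)
  set τ : ℝ := 1 / ((k : ℝ) + 1) + 4 * δ with hτ
  have hgτ := hg τ (by linarith)
  set B : ℝ := ∑' e : ℕ, |(g e : ℝ)| * (e : ℝ) ^ (-τ) with hB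
  have hB0 : 0 ≤ B := tsum_nonneg fun e ↦ by positivity
  refine ⟨C * B, fun x hx ↦ ?_⟩
  have hx0 : 0 < x := by linarith
  have hS : HasSum (fun e : ℕ ↦ (g e : ℝ) * ((∑ n ∈ Finset.Ioc 0 ⌊x / e⌋₊, T n : ℤ) : ℝ))
      ((∑ n ∈ Finset.Ioc 0 ⌊x⌋₊, (g * T) n : ℤ) : ℝ) := by
    rw [sum_Ioc_mul_eq_sum_sum]
    push_cast
    simp_rw [Nat.floor_div_natCast]
    refine hasSum_sum_of_ne_finset_zero fun e he ↦ ?_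
    rcases Nat.eq_zero_or_pos e with rfl | he0
    · simp
    · rw [Nat.div_eq_of_lt (by simp at he; omega), Finset.Ioc_self, Finset.sum_empty, mul_zero]
  have hD := hS.sub (hg1.hasSum.mul_left (c * x))
  have hbound : ∀ e : ℕ, ‖(g e : ℝ) * ((∑ n ∈ Finset.Ioc 0 ⌊x / e⌋₊, T n : ℤ) : ℝ) -
      c * x * ((g e : ℝ) * (e : ℝ)⁻¹)‖ ≤ C * x ^ τ * (|(g e : ℝ)| * (e : ℝ) ^ (-τ)) := by
    intro e
    rcases Nat.eq_zero_or_pos e with rfl | he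
    · simp
    have he' : (0 : ℝ) < e := by exact_mod_cast he
    calc _ = |(g e : ℝ)| *
          |((∑ n ∈ Finset.Ioc 0 ⌊x / e⌋₊, T n : ℤ) : ℝ) - c * (x / e)| := by
          rw [← abs_mul, Real.norm_eq_abs]
          congr 1
          ring
      _ ≤ |(g e : ℝ)| * (C * (x / e) ^ τ) := by
          gcongr
          exact hC _ (by positivity)
      _ = _ := by
          rw [Real.div_rpow hx0.le he'.le, Real.rpow_neg he'.le]
          ring
  have hfin := tsum_of_norm_bounded (hgτ.hasSum.mul_left (C * x ^ τ)) hbound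
  rw [hD.tsum_eq, Real.norm_eq_abs] at hfin
  calc _ = _ := by
        congr 1
        ring
    _ ≤ _ := hfin
    _ = C * B * x ^ τ := by ring
    _ ≤ _ := by
      gcongr
      linarith

lemma abs_le_one_of_prime_pow {f ε : ℕ → ℤ} (hf1 : f 1 = 1)
    (hmul : ∀ m n : ℕ, Nat.Coprime m n → f (m * n) = f m * f n)
    (hεval : ∀ j : ℕ, 1 ≤ j → ε j = -1 ∨ ε j = 0 ∨ ε j = 1)
    (hfp : ∀ p : ℕ, Nat.Prime p → ∀ j : ℕ, 1 ≤ j → f (p ^ j) = ε j) (n : ℕ) (hn : n ≠ 0) :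
    |f n| ≤ 1 := by
  induction n using Nat.recOnPrimeCoprime with
  | zero => exact absurd rfl hn
  | prime_pow p j hp =>
    rcases Nat.eq_zero_or_pos j with rfl | hj
    · simp [hf1]
    · rw [hfp p hp j hj]
      rcases hεval j hj with h | h | h <;> simp [h]
  | coprime a b ha hb hab iha ihb =>
    rw [hmul a b hab, abs_mul]
    exact mul_le_one₀ (iha (by omega)) (abs_nonneg _) (ihb (by omega))

lemma abs_sum_Icc_le {f : ℕ → ℤ} (hf : ∀ n, n ≠ 0 → |f n| ≤ 1) {x : ℝ} (hx : 0 ≤ x) :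
    |∑ n ∈ Finset.Icc 1 ⌊x⌋₊, (f n : ℝ)| ≤ x := by
  calc _ ≤ ∑ n ∈ Finset.Icc 1 ⌊x⌋₊, (1 : ℝ) := by
        refine (Finset.abs_sum_le_sum_abs _ _).trans (Finset.sum_le_sum fun n hn ↦ ?_)
        rw [Finset.mem_Icc] at hn
        exact_mod_cast hf n (by omega)
    _ = (⌊x⌋₊ : ℝ) := by simp
    _ ≤ x := Nat.floor_le hx

lemma IsMultiplicative.npow {u : ArithmeticFunction ℤ} (hu : u.IsMultiplicative) (a : ℕ) :
    (u ^ a).IsMultiplicative := by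
  induction a with
  | zero => simp
  | succ a ih =>
    rw [pow_succ]
    exact ih.mul hu

/-- A fake Möbius function of critical index `k ≥ 2` factors as `dilate k (μ ^ a) * ζ` times a
function whose Dirichlet series converges absolutely to the right of `1 / (k + 1)`. -/
lemma exists_factorization {F : ArithmeticFunction ℤ} (hF : F.IsMultiplicative) {ε : ℕ → ℤ}
    (hεval : ∀ j : ℕ, 1 ≤ j → ε j = -1 ∨ ε j = 0 ∨ ε j = 1)
    (hFp : ∀ p : ℕ, Nat.Prime p → ∀ j : ℕ, 1 ≤ j → F (p ^ j) = ε j)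
    {k : ℕ} (hk : 2 ≤ k) (hεk : ε k ≠ 1) (hleast : ∀ j : ℕ, 1 ≤ j → j < k → ε j = 1) :
    ∃ (a : ℕ) (g : ArithmeticFunction ℤ), 1 ≤ a ∧
      F = g * (dilate k (moebius ^ a) * (zeta : ArithmeticFunction ℤ)) ∧
      ∀ σ : ℝ, 1 / ((k : ℝ) + 1) < σ →
        Summable fun n : ℕ ↦ |(g n : ℝ)| * (n : ℝ) ^ (-σ) := by
  have hk0 : k ≠ 0 := by omega
  obtain ⟨a, ha, hak⟩ : ∃ a : ℕ, 1 ≤ a ∧ ε k = 1 - a := by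
    rcases hεval k (by omega) with h | h | h
    · exact ⟨2, by norm_num, by rw [h]; norm_num⟩
    · exact ⟨1, le_rfl, by rw [h]; norm_num⟩
    · exact absurd h hεk
  set h : ArithmeticFunction ℤ := F * moebius with hh
  set Z : ArithmeticFunction ℤ := dilate k (zeta : ArithmeticFunction ℤ) with hZ
  have hhm : h.IsMultiplicative := hF.mul isMultiplicative_moebius
  have hZm : Z.IsMultiplicative := isMultiplicative_dilate hk0 isMultiplicative_zeta.natCast
  have hhζ : h * (zeta : ArithmeticFunction ℤ) = F := by
    rw [hh, mul_assoc, moebius_mul_coe_zeta, mul_one]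
  have hF' : ∀ p : ℕ, p.Prime → ∀ j, F (p ^ j) = ∑ i ∈ Finset.range (j + 1), h (p ^ i) := by
    intro p hp j
    rw [← hhζ, coe_mul_zeta_apply, Nat.sum_divisors_prime_pow hp]
  have hhp : ∀ p : ℕ, p.Prime → ∀ j, h (p ^ (j + 1)) = F (p ^ (j + 1)) - F (p ^ j) := by
    intro p hp j
    rw [hF' p hp, hF' p hp, Finset.sum_range_succ, add_sub_cancel_left]
  have hFbd : ∀ p : ℕ, p.Prime → ∀ j, |F (p ^ j)| ≤ 1 := by
    intro p hp j
    rcases Nat.eq_zero_or_pos j with rfl | hj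
    · simp [hF.1]
    · rw [hFp p hp j hj]
      rcases hεval j hj with h | h | h <;> simp [h]
  have hFone : ∀ p : ℕ, p.Prime → ∀ j, j < k → F (p ^ j) = 1 := by
    intro p hp j hjk
    rcases Nat.eq_zero_or_pos j with rfl | hj
    · simp [hF.1]
    · rw [hFp p hp j hj, hleast j hj hjk]
  have hhbd : ∀ p : ℕ, p.Prime → ∀ j, |h (p ^ j)| ≤ 2 := by
    intro p hp j
    cases j with
    | zero => simp [hhm.1]
    | succ j =>
      rw [hhp p hp]
      exact (abs_sub _ _).trans (by linarith [hFbd p hp (j + 1), hFbd p hp j])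
  have hh0 : ∀ p : ℕ, p.Prime → ∀ i, 1 ≤ i → i < k → h (p ^ i) = 0 := by
    intro p hp i hi hik
    obtain ⟨j, rfl⟩ := Nat.exists_eq_add_of_le' hi
    rw [hhp p hp, hFone p hp _ hik, hFone p hp _ (by omega), sub_self]
  have hhk : ∀ p : ℕ, p.Prime → h (p ^ k) = -a := by
    intro p hp
    obtain ⟨j, rfl⟩ := Nat.exists_eq_add_of_le' (by omega : 1 ≤ k)
    rw [hhp p hp, hFp p hp _ (by omega), hFone p hp _ (by omega), hak]
    ring
  refine ⟨a, h * Z ^ a, ha, ?_, fun σ hσ ↦ summable_abs_mul_rpow (A := 2) (r := a)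
    (hhm.mul (IsMultiplicative.npow hZm a)) ?_ ?_ hσ⟩
  · have : Z ^ a * dilate k (moebius ^ a) = 1 := by
      rw [dilate_npow hk0, ← mul_pow, hZ, ← dilate_mul hk0, coe_zeta_mul_moebius, dilate_one hk0,
        one_pow]
    calc F = h * 1 * (zeta : ArithmeticFunction ℤ) := by rw [mul_one, hhζ]
      _ = _ := by
        rw [← this]
        ring
  · intro p hp i hi hik
    obtain ⟨-, h2, h3⟩ := mul_dilate_zeta_pow_apply hk0 hp hhm.1 (hh0 p hp) a
    rcases hik.lt_or_eq with hik | rfl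
    · exact h2 i hi hik
    · rw [h3, hhk p hp, neg_add_cancel]
  · exact fun p hp j ↦ abs_mul_dilate_zeta_pow_le hk0 hp (hhbd p hp) a j

end

end FakeMu

/-- conditional upper bound, powerfree-type.
Assume the Riemann hypothesis.  If `f` is a fake μ defined via `(ε_j)` with
`ε_1 = 1` and `k` is the least integer with `ε_k ≠ 1`, then there is a real
constant `c₁` such that for every `ε > 0`,
`Σ_{n ≤ x} f(n) - c₁ x ≪_ε x^{1/(k+1)+ε}`. -/
theorem stmt_15
    (hRH : ∀ ρ : ℂ, riemannZeta ρ = 0 → 0 < ρ.re → ρ.re < 1 → ρ.re = 1 / 2)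
    (f : ℕ → ℤ) (ε : ℕ → ℤ)
    (hf1 : f 1 = 1)
    (hmul : ∀ m n : ℕ, Nat.Coprime m n → f (m * n) = f m * f n)
    (hεval : ∀ j : ℕ, 1 ≤ j → ε j = -1 ∨ ε j = 0 ∨ ε j = 1)
    (hfp : ∀ p : ℕ, Nat.Prime p → ∀ j : ℕ, 1 ≤ j → f (p ^ j) = ε j)
    (hε1 : ε 1 = 1)
    (k : ℕ) (hεk : ε k ≠ 1) (hleast : ∀ j : ℕ, 1 ≤ j → j < k → ε j = 1) :
    ∃ c₁ : ℝ, ∀ ε' : ℝ, 0 < ε' → ∃ C : ℝ, ∀ᶠ x : ℝ in atTop,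
      |(∑ n ∈ Finset.Icc 1 ⌊x⌋₊, (f n : ℝ)) - c₁ * x| ≤
        C * x ^ (1 / ((k : ℝ) + 1) + ε') := by
  rcases Nat.lt_or_ge k 2 with hk | hk
  · interval_cases k
    · refine ⟨0, fun ε' hε' ↦ ⟨1, ?_⟩⟩
      filter_upwards [eventually_ge_atTop 1] with x hx
      rw [zero_mul, sub_zero, one_mul]
      refine (FakeMu.abs_sum_Icc_le (FakeMu.abs_le_one_of_prime_pow hf1 hmul hεval hfp)
        (by linarith)).trans ?_
      refine Real.self_le_rpow_of_one_le hx ?_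
      norm_num
      exact hε'.le
    · exact absurd hε1 hεk
  let F : ArithmeticFunction ℤ := ⟨fun n ↦ if n = 0 then 0 else f n, if_pos rfl⟩
  have hFf : ∀ n, n ≠ 0 → F n = f n := fun n hn ↦ if_neg hn
  have hF : F.IsMultiplicative := by
    refine ⟨(hFf 1 one_ne_zero).trans hf1, fun {m n} hmn ↦ ?_⟩
    rcases eq_or_ne m 0 with rfl | hm
    · simp
    rcases eq_or_ne n 0 with rfl | hn
    · simp
    rw [hFf _ (mul_ne_zero hm hn), hFf m hm, hFf n hn, hmul m n hmn]
  obtain ⟨a, g, ha, hFg, hg⟩ := FakeMu.exists_factorization hF hεval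
    (fun p hp j hj ↦ (hFf _ (pow_ne_zero _ hp.ne_zero)).trans (hfp p hp j hj)) hk hεk hleast
  obtain ⟨c₁, hc₁⟩ := FakeMu.RH.exists_sum_bound hRH hk ha hg
  refine ⟨c₁, fun ε' hε' ↦ ?_⟩
  obtain ⟨C, hC⟩ := hc₁ ε' hε'
  refine ⟨C, ?_⟩
  filter_upwards [eventually_ge_atTop 1] with x hx
  have hsum : ∑ n ∈ Finset.Icc 1 ⌊x⌋₊, (f n : ℝ) =
      ((∑ n ∈ Finset.Ioc 0 ⌊x⌋₊, F n : ℤ) : ℝ) := by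
    push_cast
    refine Finset.sum_congr rfl fun n hn ↦ ?_
    rw [Finset.mem_Ioc] at hn
    rw [hFf n (by omega)]
  rw [hsum, hFg]
  exact hC x hx
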